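/- arXiv:2212.03085 — 2 statements merged into one kernel-verified Lean document; each statement's English description precedes it below -/
import Mathlib

section
/- Suppose Σ is a theory in a countable multi-sorted first-order language, S₀ ⊆ S₁ are subsets of the sorts, and S₁ is implicitly interpretable over S₀ relative to Σ (every isomorphism between the S₀-parts of two models of Σ extends uniquely to a map preserving all relations over S₁). Then in every countable model M of Σ, the type of any tuple b over S₁ with parameters from S₀ is isolated by a single formula with parameters from S₀. -/
/-- A multi-sorted relational signature: a type of sorts, a type of relation symbols,
and an arity (list of argument sorts) for each relation symbol. -/
structure MSig : Type 1 where
  Sorts : Type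
  Rels : Type
  arity : Rels → List Sorts

/-- A structure for a multi-sorted relational signature. -/
structure MStr (σ : MSig) : Type 1 where
  dom : σ.Sorts → Type
  rel : ∀ r : σ.Rels,
    ((i : Fin (σ.arity r).length) → dom ((σ.arity r).get i)) → Prop

variable {σ : MSig}

/-- A variable of sort `s` in the context `Γ`. -/
def MVar (Γ : List σ.Sorts) (s : σ.Sorts) : Type := { i : Fin Γ.length // Γ.get i = s }

/-- Multi-sorted first-order formulas over `σ`, in a context `Γ` of sorts of free
variables (de Bruijn style). -/
inductive MForm (σ : MSig) : List σ.Sorts → Type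
  | rel {Γ} (r : σ.Rels)
      (args : (i : Fin (σ.arity r).length) → MVar Γ ((σ.arity r).get i)) : MForm σ Γ
  | eq {Γ} {s : σ.Sorts} : MVar Γ s → MVar Γ s → MForm σ Γ
  | fal {Γ} : MForm σ Γ
  | imp {Γ} : MForm σ Γ → MForm σ Γ → MForm σ Γ
  | all {Γ} (s : σ.Sorts) : MForm σ (s :: Γ) → MForm σ Γ

def MForm.not {Γ : List σ.Sorts} (φ : MForm σ Γ) : MForm σ Γ := φ.imp .fal

def MForm.ex {Γ : List σ.Sorts} (s : σ.Sorts) (φ : MForm σ (s :: Γ)) : MForm σ Γ :=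
  (MForm.all s φ.not).not

/-- An assignment of elements to the variables of a context. -/
def MEnv (M : MStr σ) (Γ : List σ.Sorts) : Type := (i : Fin Γ.length) → M.dom (Γ.get i)

def MEnv.nil {M : MStr σ} : MEnv M [] := fun i => i.elim0

def MEnv.cons {M : MStr σ} {s : σ.Sorts} {Γ : List σ.Sorts} (x : M.dom s)
    (ρ : MEnv M Γ) : MEnv M (s :: Γ) := fun i =>
  Fin.cases (motive := fun i => M.dom ((s :: Γ).get i)) x (fun j => ρ j) i

def MEnv.tail {M : MStr σ} {s : σ.Sorts} {Γ : List σ.Sorts} (ρ : MEnv M (s :: Γ)) :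
    MEnv M Γ := fun i => ρ i.succ

def MEnv.append {M : MStr σ} {Γ₂ : List σ.Sorts} (ρ₂ : MEnv M Γ₂) :
    ∀ {Γ₁ : List σ.Sorts}, MEnv M Γ₁ → MEnv M (Γ₁ ++ Γ₂)
  | [], _ => ρ₂
  | _ :: _, ρ₁ => MEnv.cons (ρ₁ ⟨0, Nat.succ_pos _⟩) (MEnv.append ρ₂ ρ₁.tail)

/-- The value of a variable under an assignment. -/
def MVar.val {M : MStr σ} {Γ : List σ.Sorts} {s : σ.Sorts} (v : MVar Γ s)
    (ρ : MEnv M Γ) : M.dom s := cast (congrArg M.dom v.2) (ρ v.1)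

/-- Satisfaction of a multi-sorted formula. -/
def MForm.Sat {M : MStr σ} : ∀ {Γ}, MForm σ Γ → MEnv M Γ → Prop
  | _, .rel r args, ρ => M.rel r (fun i => (args i).val ρ)
  | _, .eq v w, ρ => v.val ρ = w.val ρ
  | _, .fal, _ => False
  | _, .imp φ ψ, ρ => φ.Sat ρ → ψ.Sat ρ
  | _, .all _ φ, ρ => ∀ x, φ.Sat (MEnv.cons x ρ)

/-- A structure models a set of sentences. -/
def MStr.Models (M : MStr σ) (T : Set (MForm σ [])) : Prop :=
  ∀ φ ∈ T, φ.Sat (MEnv.nil (M := M))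

/-- A relation symbol is *over* a set of sorts `S` when all its argument sorts lie in `S`. -/
def RelOver (S : Set σ.Sorts) (r : σ.Rels) : Prop :=
  ∀ i : Fin (σ.arity r).length, (σ.arity r).get i ∈ S

/-- A formula is *over* a set of sorts `S` when all its relation symbols and all its
quantified sorts lie in `S`. -/
def MForm.Over (S : Set σ.Sorts) : ∀ {Γ : List σ.Sorts}, MForm σ Γ → Prop
  | _, .rel r _ => RelOver S r
  | _, .eq _ _ => True
  | _, .fal => True
  | _, .imp φ ψ => φ.Over S ∧ ψ.Over S
  | _, .all s φ => s ∈ S ∧ φ.Over S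

/-- `S₁` is *implicitly interpretable* over `S₀` relative to the theory `T`: for any two
models `M`, `N` of `T`, every isomorphism between the `S₀`-parts (a family of bijections,
one per sort of `S₀`, preserving all relations over `S₀` in both directions) extends to a
unique mapping between the `S₁`-parts preserving all relations over `S₁`. -/
def ImplInterp (T : Set (MForm σ [])) (S0 S1 : Set σ.Sorts) (h01 : S0 ⊆ S1) : Prop :=
  ∀ (M N : MStr σ), M.Models T → N.Models T →
    ∀ f : ∀ s : σ.Sorts, s ∈ S0 → M.dom s → N.dom s,
      (∀ s (hs : s ∈ S0), Function.Bijective (f s hs)) →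
      (∀ (r : σ.Rels) (hr : RelOver S0 r)
        (a : (i : Fin (σ.arity r).length) → M.dom ((σ.arity r).get i)),
        M.rel r a ↔ N.rel r (fun i => f _ (hr i) (a i))) →
      ∃! g : ∀ s : σ.Sorts, s ∈ S1 → M.dom s → N.dom s,
        (∀ s (hs : s ∈ S0), g s (h01 hs) = f s hs) ∧
        (∀ (r : σ.Rels) (hr : RelOver S1 r)
          (a : (i : Fin (σ.arity r).length) → M.dom ((σ.arity r).get i)),
          M.rel r a → N.rel r (fun i => g _ (hr i) (a i)))

section Syn

theorem MEnv.val_zero {M : MStr σ} {s : σ.Sorts} {Γ : List σ.Sorts} (x : M.dom s)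
    (ρ : MEnv M Γ) :
    MVar.val (⟨⟨0, Nat.succ_pos _⟩, rfl⟩ : MVar (s :: Γ) s) (MEnv.cons x ρ) = x := rfl

/-- Weakening of a variable. -/
def MVar.wk {Γ : List σ.Sorts} {t : σ.Sorts} (s : σ.Sorts) (v : MVar Γ t) : MVar (s :: Γ) t :=
  ⟨v.1.succ, v.2⟩

theorem MVar.val_wk {M : MStr σ} {s t : σ.Sorts} {Γ : List σ.Sorts} (x : M.dom s)
    (ρ : MEnv M Γ) (v : MVar Γ t) : (v.wk s).val (MEnv.cons x ρ) = v.val ρ := rfl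

theorem MVar.cons_cases {Γ : List σ.Sorts} {s t : σ.Sorts} (v : MVar (s :: Γ) t) :
    (∃ h : s = t, v = ⟨⟨0, Nat.succ_pos _⟩, h⟩) ∨ ∃ w : MVar Γ t, v = w.wk s := by
  obtain ⟨i, hi⟩ := v
  refine Fin.cases (motive := fun i => ∀ hi, (∃ h : s = t, (⟨i, hi⟩ : MVar (s :: Γ) t) = ⟨⟨0, Nat.succ_pos _⟩, h⟩) ∨ ∃ w : MVar Γ t, (⟨i, hi⟩ : MVar (s :: Γ) t) = w.wk s) ?_ ?_ i hi
  · intro hi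
    exact Or.inl ⟨hi, rfl⟩
  · intro j hj
    exact Or.inr ⟨⟨j, hj⟩, rfl⟩

theorem MEnv.cons_eta {M : MStr σ} {s : σ.Sorts} {Γ : List σ.Sorts} (ρ : MEnv M (s :: Γ)) :
    MEnv.cons (ρ ⟨0, Nat.succ_pos _⟩) ρ.tail = ρ := by
  funext i
  refine Fin.cases ?_ ?_ i
  · rfl
  · intro j; rfl

/-- Change of context. -/
theorem rename_exists {M : MStr σ} {Γ : List σ.Sorts} (φ : MForm σ Γ) :
    ∀ (Γ' : List σ.Sorts) (ι : Type) (ρ : ι → MEnv M Γ) (ρ' : ι → MEnv M Γ'),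
      (∀ s (v : MVar Γ s), ∃ v' : MVar Γ' s, ∀ i, v.val (ρ i) = v'.val (ρ' i)) →
      ∃ φ' : MForm σ Γ', ∀ i, φ.Sat (ρ i) ↔ φ'.Sat (ρ' i) := by
  induction φ with
  | rel r args =>
    intro Γ' ι ρ ρ' h
    choose v hv using fun k => h _ (args k)
    refine ⟨.rel r v, fun i => ?_⟩
    simp only [MForm.Sat]
    simp only [hv]
  | eq v w =>
    intro Γ' ι ρ ρ' h
    obtain ⟨v', hv⟩ := h _ v
    obtain ⟨w', hw⟩ := h _ w
    refine ⟨.eq v' w', fun i => ?_⟩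
    simp only [MForm.Sat, hv, hw]
  | fal =>
    intro Γ' ι ρ ρ' h
    exact ⟨.fal, fun i => by simp only [MForm.Sat]⟩
  | imp φ ψ ih1 ih2 =>
    intro Γ' ι ρ ρ' h
    obtain ⟨φ', h1⟩ := ih1 Γ' ι ρ ρ' h
    obtain ⟨ψ', h2⟩ := ih2 Γ' ι ρ ρ' h
    exact ⟨.imp φ' ψ', fun i => by simp only [MForm.Sat, h1, h2]⟩
  | all s φ ih =>
    intro Γ' ι ρ ρ' h
    obtain ⟨φ', h1⟩ := ih (s :: Γ') (ι × M.dom s) (fun i => MEnv.cons i.2 (ρ i.1))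
      (fun i => MEnv.cons i.2 (ρ' i.1)) (by
        intro t v
        rcases v.cons_cases with ⟨rfl, rfl⟩ | ⟨w, rfl⟩
        · exact ⟨⟨⟨0, Nat.succ_pos _⟩, rfl⟩, fun i => rfl⟩
        · obtain ⟨w', hw⟩ := h _ w
          exact ⟨w'.wk s, fun i => hw i.1⟩)
    refine ⟨.all s φ', fun i => ?_⟩
    simp only [MForm.Sat]
    exact forall_congr' fun x => h1 (i, x)

theorem append_inl {M : MStr σ} {Γ₁ Γ₂ : List σ.Sorts} {s : σ.Sorts} (v : MVar Γ₁ s) :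
    ∃ v' : MVar (Γ₁ ++ Γ₂) s, ∀ (ρ₁ : MEnv M Γ₁) (ρ₂ : MEnv M Γ₂),
      v'.val (MEnv.append ρ₂ ρ₁) = v.val ρ₁ := by
  induction Γ₁ with
  | nil => exact v.1.elim0
  | cons t Γ ih =>
    rcases v.cons_cases with ⟨rfl, rfl⟩ | ⟨w, rfl⟩
    · exact ⟨⟨⟨0, Nat.succ_pos _⟩, rfl⟩, fun _ _ => rfl⟩
    · obtain ⟨w', hw⟩ := ih w
      exact ⟨w'.wk t, fun ρ₁ ρ₂ => hw ρ₁.tail ρ₂⟩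

theorem append_inr {M : MStr σ} {Γ₁ Γ₂ : List σ.Sorts} {s : σ.Sorts} (v : MVar Γ₂ s) :
    ∃ v' : MVar (Γ₁ ++ Γ₂) s, ∀ (ρ₁ : MEnv M Γ₁) (ρ₂ : MEnv M Γ₂),
      v'.val (MEnv.append ρ₂ ρ₁) = v.val ρ₂ := by
  induction Γ₁ with
  | nil => exact ⟨v, fun _ _ => rfl⟩
  | cons t Γ ih =>
    obtain ⟨w', hw⟩ := ih
    exact ⟨w'.wk t, fun ρ₁ ρ₂ => hw ρ₁.tail ρ₂⟩

theorem append_cases (M : MStr σ) {Γ₁ Γ₂ : List σ.Sorts} {s : σ.Sorts} (v : MVar (Γ₁ ++ Γ₂) s) :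
    (∃ w : MVar Γ₁ s, ∀ (ρ₁ : MEnv M Γ₁) (ρ₂ : MEnv M Γ₂),
      v.val (MEnv.append ρ₂ ρ₁) = w.val ρ₁) ∨
    (∃ w : MVar Γ₂ s, ∀ (ρ₁ : MEnv M Γ₁) (ρ₂ : MEnv M Γ₂),
      v.val (MEnv.append ρ₂ ρ₁) = w.val ρ₂) := by
  induction Γ₁ with
  | nil => exact Or.inr ⟨v, fun _ _ => rfl⟩
  | cons t Γ ih =>
    rcases MVar.cons_cases (Γ := Γ ++ Γ₂) v with ⟨rfl, rfl⟩ | ⟨w, rfl⟩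
    · exact Or.inl ⟨⟨⟨0, Nat.succ_pos _⟩, rfl⟩, fun _ _ => rfl⟩
    · rcases ih w with ⟨w', hw⟩ | ⟨w', hw⟩
      · exact Or.inl ⟨w'.wk t, fun ρ₁ ρ₂ => hw ρ₁.tail ρ₂⟩
      · exact Or.inr ⟨w', fun ρ₁ ρ₂ => hw ρ₁.tail ρ₂⟩

theorem append_cons {M : MStr σ} {Γ₁ Γ₂ : List σ.Sorts} {s : σ.Sorts} (x : M.dom s)
    (ρ₁ : MEnv M Γ₁) (ρ₂ : MEnv M Γ₂) :
    MEnv.append ρ₂ (MEnv.cons x ρ₁) = MEnv.cons x (MEnv.append ρ₂ ρ₁) := rfl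

theorem sat_ex {M : MStr σ} {Γ : List σ.Sorts} {s : σ.Sorts} (φ : MForm σ (s :: Γ))
    (ρ : MEnv M Γ) : (MForm.ex s φ).Sat ρ ↔ ∃ x, φ.Sat (MEnv.cons x ρ) := by
  simp only [MForm.ex, MForm.not, MForm.Sat]
  constructor
  · intro h; by_contra h'; exact h fun x hx => h' ⟨x, hx⟩
  · rintro ⟨x, hx⟩ h; exact h x hx

/-- Countability of formulas. -/
def MForm.upTo (σ : MSig) : ℕ → ∀ Γ : List σ.Sorts, Set (MForm σ Γ)
  | 0, _ => ∅
  | n + 1, Γ =>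
    Set.range (fun q : (Σ r : σ.Rels, (i : Fin (σ.arity r).length) → MVar Γ ((σ.arity r).get i)) =>
        MForm.rel q.1 q.2) ∪
      Set.range (fun q : (Σ s : σ.Sorts, MVar Γ s × MVar Γ s) => MForm.eq q.2.1 q.2.2) ∪
      {MForm.fal} ∪ Set.image2 MForm.imp (MForm.upTo σ n Γ) (MForm.upTo σ n Γ) ∪
      ⋃ s : σ.Sorts, MForm.all s '' (MForm.upTo σ n (s :: Γ))

instance (Γ : List σ.Sorts) (s : σ.Sorts) : Countable (MVar Γ s) :=
  inferInstanceAs (Countable { i : Fin Γ.length // Γ.get i = s })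

theorem MForm.upTo_countable (σ : MSig) [Countable σ.Sorts] [Countable σ.Rels] (n : ℕ) :
    ∀ Γ : List σ.Sorts, (MForm.upTo σ n Γ).Countable := by
  induction n with
  | zero => intro Γ; exact Set.countable_empty
  | succ n ih =>
    intro Γ
    simp only [MForm.upTo]
    refine ((((Set.countable_range _).union (Set.countable_range _)).union
      (Set.countable_singleton _)).union ((ih Γ).image2 (ih Γ) _)).union ?_
    exact Set.countable_iUnion fun s => (ih (s :: Γ)).image _

theorem MForm.upTo_mono (σ : MSig) (n : ℕ) :
    ∀ Γ : List σ.Sorts, MForm.upTo σ n Γ ⊆ MForm.upTo σ (n + 1) Γ := by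
  induction n with
  | zero => intro Γ; exact Set.empty_subset _
  | succ n ih =>
    intro Γ
    rw [MForm.upTo, MForm.upTo]
    refine Set.union_subset_union (Set.union_subset_union le_rfl (Set.image2_subset (ih Γ) (ih Γ))) ?_
    exact Set.iUnion_mono fun s => Set.image_mono (ih _)

theorem MForm.upTo_mono' (σ : MSig) {n m : ℕ} (h : n ≤ m) (Γ : List σ.Sorts) :
    MForm.upTo σ n Γ ⊆ MForm.upTo σ m Γ :=
  monotone_nat_of_le_succ (f := fun n => MForm.upTo σ n Γ) (fun n => MForm.upTo_mono σ n Γ) h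

theorem MForm.mem_upTo {Γ : List σ.Sorts} (φ : MForm σ Γ) : ∃ n, φ ∈ MForm.upTo σ n Γ := by
  induction φ with
  | rel r args => exact ⟨1, by rw [upTo]; left; left; left; left; exact ⟨⟨r, args⟩, rfl⟩⟩
  | eq v w => exact ⟨1, by rw [upTo]; left; left; left; right; exact ⟨⟨_, v, w⟩, rfl⟩⟩
  | fal => exact ⟨1, by rw [upTo]; left; left; right; rfl⟩
  | imp φ ψ h1 h2 =>
    obtain ⟨n, hn⟩ := h1
    obtain ⟨m, hm⟩ := h2
    refine ⟨max n m + 1, ?_⟩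
    rw [upTo]; left; right
    exact ⟨φ, upTo_mono' σ (le_max_left _ _) _ hn, ψ, upTo_mono' σ (le_max_right _ _) _ hm, rfl⟩
  | all s φ h =>
    obtain ⟨n, hn⟩ := h
    refine ⟨n + 1, ?_⟩
    rw [upTo]; right
    exact Set.mem_iUnion.2 ⟨s, φ, hn, rfl⟩

instance [Countable σ.Sorts] [Countable σ.Rels] (Γ : List σ.Sorts) : Countable (MForm σ Γ) := by
  rw [← Set.countable_univ_iff]
  refine (Set.countable_iUnion fun n => MForm.upTo_countable σ n Γ).mono ?_
  intro φ _
  obtain ⟨n, hn⟩ := φ.mem_upTo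
  exact Set.mem_iUnion.2 ⟨n, hn⟩

/-- Isomorphisms from the implicit interpretation. -/
theorem twoway {T : Set (MForm σ [])} {S0 S1 : Set σ.Sorts} {h01 : S0 ⊆ S1}
    (himp : ImplInterp T S0 S1 h01) (A B : MStr σ) (hA : A.Models T) (hB : B.Models T)
    (f : ∀ s : σ.Sorts, s ∈ S0 → A.dom s → B.dom s)
    (hf : ∀ s (hs : s ∈ S0), Function.Bijective (f s hs))
    (hr : ∀ (r : σ.Rels) (hr : RelOver S0 r)
        (a : (i : Fin (σ.arity r).length) → A.dom ((σ.arity r).get i)),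
        A.rel r a ↔ B.rel r (fun i => f _ (hr i) (a i))) :
    ∃ (g : ∀ s : σ.Sorts, s ∈ S1 → A.dom s → B.dom s)
      (g' : ∀ s : σ.Sorts, s ∈ S1 → B.dom s → A.dom s),
      (∀ s (hs : s ∈ S0), g s (h01 hs) = f s hs) ∧
      (∀ (r : σ.Rels) (hr : RelOver S1 r) a, A.rel r a → B.rel r (fun i => g _ (hr i) (a i))) ∧
      (∀ s (hs : s ∈ S0) x, g' s (h01 hs) (f s hs x) = x) ∧
      (∀ (r : σ.Rels) (hr : RelOver S1 r) a, B.rel r a → A.rel r (fun i => g' _ (hr i) (a i))) ∧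
      (∀ s hs x, g' s hs (g s hs x) = x) := by
  obtain ⟨g, ⟨hg1, hg2⟩, -⟩ := himp A B hA hB f hf hr
  obtain ⟨g', ⟨hg1', hg2'⟩, -⟩ := himp B A hB hA
    (fun s hs => (Equiv.ofBijective _ (hf s hs)).symm)
    (fun s hs => (Equiv.ofBijective _ (hf s hs)).symm.bijective) (by
      intro r hr' a
      rw [hr r hr']
      simp only [Equiv.ofBijective_apply_symm_apply])
  have e1 : ∀ s (hs : s ∈ S0) x, g' s (h01 hs) (f s hs x) = x := by
    intro s hs x
    rw [hg1']
    exact Equiv.ofBijective_symm_apply_apply _ _ _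
  refine ⟨g, g', hg1, hg2, e1, hg2', ?_⟩
  obtain ⟨k, -, hk⟩ := himp A A hA hA (fun s hs x => x) (fun s hs => Function.bijective_id)
    (fun r hr a => Iff.rfl)
  have k1 := hk (fun s hs x => x) ⟨fun s hs => rfl, fun r hr a h => h⟩
  have k2 := hk (fun s hs x => g' s hs (g s hs x)) ⟨fun s hs => by
    funext x
    show g' s (h01 hs) (g s (h01 hs) x) = x
    rw [hg1 s hs, e1 s hs], fun r hr a h => hg2' r hr _ (hg2 r hr _ h)⟩
  intro s hs x
  have := k2.trans k1.symm
  exact congrFun (congrFun (congrFun this s) hs) x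

end Syn
section Names

/-- Names: parameters for the sorts in `S0`, countably many variables for the others. -/
inductive Nm (M : MStr σ) (S0 : Set σ.Sorts) : σ.Sorts → Type
  | par {s : σ.Sorts} (hs : s ∈ S0) (m : M.dom s) : Nm M S0 s
  | var {s : σ.Sorts} (hs : s ∉ S0) (hne : Nonempty (M.dom s)) (n : ℕ) : Nm M S0 s

/-- The names as a structure, so that environments of names make sense. -/
abbrev NmS (M : MStr σ) (S0 : Set σ.Sorts) : MStr σ := ⟨Nm M S0, fun _ _ => False⟩

theorem Nm.countable (M : MStr σ) (S0 : Set σ.Sorts) (s : σ.Sorts) [Countable (M.dom s)] :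
    Countable (Nm M S0 s) := by
  let F : Nm M S0 s → M.dom s ⊕ ℕ := fun n => match n with
    | .par _ m => Sum.inl m
    | .var _ _ n => Sum.inr n
  refine Function.Injective.countable (f := F) ?_
  rintro (⟨hs, m⟩ | ⟨hs, hne, n⟩) (⟨hs', m'⟩ | ⟨hs', hne', n'⟩) h <;> simp_all [F]

/-- Valuations of names in `M`, fixing the parameters. -/
structure MVal (M : MStr σ) (S0 : Set σ.Sorts) where
  e : ∀ s, Nm M S0 s → M.dom s
  epar : ∀ s (hs : s ∈ S0) (m : M.dom s), e s (.par hs m) = m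

variable {M : MStr σ} {S0 : Set σ.Sorts}

instance : Nonempty (MVal M S0) :=
  ⟨⟨fun _ n => match n with
    | .par _ m => m
    | .var _ hne _ => Classical.choice hne, fun _ _ _ => rfl⟩⟩

theorem MVal.eq_of_mem (e e' : MVal M S0) {s : σ.Sorts} (hs : s ∈ S0) (n : Nm M S0 s) :
    e.e s n = e'.e s n := by
  cases n with
  | par _ m => rw [e.epar, e'.epar]
  | var h _ _ => exact absurd hs h

def MVal.env (e : MVal M S0) {Γ : List σ.Sorts} (ν : MEnv (NmS M S0) Γ) : MEnv M Γ :=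
  fun i => e.e _ (ν i)

theorem MVal.env_cons (e : MVal M S0) {Γ : List σ.Sorts} {s : σ.Sorts} (n : Nm M S0 s)
    (ν : MEnv (NmS M S0) Γ) :
    e.env (MEnv.cons (M := NmS M S0) n ν) = MEnv.cons (e.e s n) (e.env ν) := by
  funext i
  refine Fin.cases ?_ ?_ i
  · rfl
  · intro j; rfl

theorem MVal.val_env (e : MVal M S0) {Γ : List σ.Sorts} {s : σ.Sorts} (v : MVar Γ s)
    (ν : MEnv (NmS M S0) Γ) : v.val (e.env ν) = e.e s (v.val ν) := by
  obtain ⟨i, rfl⟩ := v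
  rfl

/-- Sentences with names. -/
structure Sen (M : MStr σ) (S0 : Set σ.Sorts) : Type where
  ctx : List σ.Sorts
  form : MForm σ ctx
  nu : MEnv (NmS M S0) ctx

variable (M S0) in
theorem Sen.countable [Countable σ.Sorts] [Countable σ.Rels] [∀ s, Countable (M.dom s)] :
    Countable (Sen M S0) := by
  have : ∀ s, Countable ((NmS M S0).dom s) := fun s => Nm.countable M S0 s
  have : ∀ Γ, Countable (MEnv (NmS M S0) Γ) := fun Γ =>
    inferInstanceAs (Countable ((i : Fin Γ.length) → (NmS M S0).dom (Γ.get i)))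
  refine Function.Injective.countable (β := Σ Γ : List σ.Sorts, MForm σ Γ × MEnv (NmS M S0) Γ)
    (f := fun t => ⟨t.ctx, t.form, t.nu⟩) ?_
  rintro ⟨Γ, φ, ν⟩ ⟨Γ', φ', ν'⟩ h
  simp only [Sigma.mk.injEq] at h
  obtain ⟨rfl, h⟩ := h
  simp only [heq_eq_eq, Prod.mk.injEq] at h
  obtain ⟨rfl, rfl⟩ := h
  rfl

open Classical in
/-- Truth vector of a valuation. -/
noncomputable def tv (e : MVal M S0) : Sen M S0 → Bool := fun t => decide (t.form.Sat (e.env t.nu))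

theorem tv_iff (e : MVal M S0) {Γ : List σ.Sorts} (φ : MForm σ Γ) (ν : MEnv (NmS M S0) Γ) :
    tv e ⟨Γ, φ, ν⟩ = true ↔ φ.Sat (e.env ν) := by
  simp [tv]

variable (M S0) in
/-- The complete theories finitely satisfiable in `M`. -/
def X0 : Set (Sen M S0 → Bool) := closure (Set.range tv)

theorem open_fin {U : Set (Sen M S0 → Bool)} (hU : IsOpen U) {p : Sen M S0 → Bool} (hp : p ∈ U) :
    ∃ F : Finset (Sen M S0), ∀ q : Sen M S0 → Bool, (∀ t ∈ F, q t = p t) → q ∈ U := by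
  obtain ⟨F, u, h1, h2⟩ := isOpen_pi_iff.1 hU p hp
  refine ⟨F, fun q hq => h2 ?_⟩
  intro t ht
  rw [hq t ht]
  exact (h1 t ht).2

theorem X0.open_sat {p : Sen M S0 → Bool} (hp : p ∈ X0 M S0) {U : Set (Sen M S0 → Bool)}
    (hU : IsOpen U) (hpU : p ∈ U) : ∃ e : MVal M S0, tv e ∈ U := by
  obtain ⟨_, h1, e, rfl⟩ := mem_closure_iff.1 hp U hU hpU
  exact ⟨e, h1⟩

theorem isOpen_coord (t : Sen M S0) (b : Bool) : IsOpen {q : Sen M S0 → Bool | q t = b} :=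
  (isOpen_discrete ({b} : Set Bool)).preimage (continuous_apply (A := fun _ : Sen M S0 => Bool) t)

theorem X0.fin_sat {p : Sen M S0 → Bool} (hp : p ∈ X0 M S0) {F : Set (Sen M S0)} (hF : F.Finite) :
    ∃ e : MVal M S0, ∀ t ∈ F, tv e t = p t := by
  obtain ⟨e, he⟩ := X0.open_sat hp (U := ⋂ t ∈ F, {q | q t = p t})
    (hF.isOpen_biInter fun t _ => isOpen_coord t _) (by simp)
  exact ⟨e, by simpa using he⟩

/-- Equality sentence. -/
def Sen.eq {s : σ.Sorts} (c c' : Nm M S0 s) : Sen M S0 :=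
  ⟨[s, s], .eq ⟨⟨0, by simp⟩, rfl⟩ ⟨⟨1, by simp⟩, rfl⟩,
    MEnv.cons (M := NmS M S0) c (MEnv.cons (M := NmS M S0) c' MEnv.nil)⟩

theorem tv_eq (e : MVal M S0) {s : σ.Sorts} (c c' : Nm M S0 s) :
    tv e (Sen.eq c c') = true ↔ e.e s c = e.e s c' := by
  rw [Sen.eq, tv_iff]
  rfl

def MVar.self {Γ : List σ.Sorts} (i : Fin Γ.length) : MVar Γ (Γ.get i) := ⟨i, rfl⟩

/-- Atomic relation sentence. -/
def Sen.rel (r : σ.Rels) (ν : (i : Fin (σ.arity r).length) → Nm M S0 ((σ.arity r).get i)) :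
    Sen M S0 :=
  ⟨σ.arity r, .rel r (fun i => MVar.self i), ν⟩

theorem tv_rel (e : MVal M S0) (r : σ.Rels)
    (ν : (i : Fin (σ.arity r).length) → Nm M S0 ((σ.arity r).get i)) :
    tv e (Sen.rel r ν) = true ↔ M.rel r (fun i => e.e _ (ν i)) := by
  exact tv_iff e (MForm.rel r fun i => MVar.self i) ν

/-- The Henkin property. -/
def Henkin (p : Sen M S0 → Bool) : Prop :=
  ∀ (Γ : List σ.Sorts) (s : σ.Sorts) (φ : MForm σ (s :: Γ)) (ν : MEnv (NmS M S0) Γ),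
    p ⟨Γ, .all s φ, ν⟩ = false → ∃ n : Nm M S0 s, p ⟨s :: Γ, φ, MEnv.cons (M := NmS M S0) n ν⟩ = false

variable (M S0) in
def XH : Set (Sen M S0 → Bool) := {p | p ∈ X0 M S0 ∧ Henkin p}

theorem X0.eq_equiv {p : Sen M S0 → Bool} (hp : p ∈ X0 M S0) (s : σ.Sorts) :
    Equivalence (fun c c' : Nm M S0 s => p (Sen.eq c c') = true) where
  refl c := by
    obtain ⟨e, he⟩ := X0.fin_sat hp (Set.finite_singleton (Sen.eq c c))
    rw [← he _ rfl, tv_eq]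
  symm {c c'} h := by
    obtain ⟨e, he⟩ := X0.fin_sat hp (Set.toFinite {Sen.eq c c', Sen.eq c' c})
    rw [← he _ (by simp), tv_eq] at h ⊢
    exact h.symm
  trans {c c' c''} h h' := by
    obtain ⟨e, he⟩ := X0.fin_sat hp (Set.toFinite {Sen.eq c c', Sen.eq c' c'', Sen.eq c c''})
    rw [← he _ (by simp), tv_eq] at h h' ⊢
    exact h.trans h'

theorem X0.congr {p : Sen M S0 → Bool} (hp : p ∈ X0 M S0) {Γ : List σ.Sorts} (φ : MForm σ Γ)
    (ν ν' : MEnv (NmS M S0) Γ)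
    (h : ∀ i, p (Sen.eq (s := Γ.get i) (ν i) (ν' i)) = true) :
    p ⟨Γ, φ, ν⟩ = p ⟨Γ, φ, ν'⟩ := by
  obtain ⟨e, he⟩ := X0.fin_sat hp (F := Set.range
      (fun i => Sen.eq (s := Γ.get i) (ν i) (ν' i)) ∪ {⟨Γ, φ, ν⟩, ⟨Γ, φ, ν'⟩})
    ((Set.finite_range _).union (Set.toFinite _))
  rw [← he ⟨Γ, φ, ν⟩ (Or.inr (Or.inl rfl)), ← he ⟨Γ, φ, ν'⟩ (Or.inr (Or.inr rfl)), Bool.eq_iff_iff, tv_iff, tv_iff]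
  have : e.env ν = e.env ν' := by
    funext i
    have := h i
    rw [← he _ (Or.inl ⟨i, rfl⟩), tv_eq] at this
    exact this
  rw [this]

/-- The term model. -/
abbrev NSetoid {p : Sen M S0 → Bool} (hp : p ∈ X0 M S0) (s : σ.Sorts) : Setoid (Nm M S0 s) :=
  ⟨_, X0.eq_equiv hp s⟩

def NMod {p : Sen M S0 → Bool} (hp : p ∈ X0 M S0) : MStr σ where
  dom s := Quotient (NSetoid hp s)
  rel r a := ∃ ν : (i : Fin (σ.arity r).length) → Nm M S0 ((σ.arity r).get i),
    (∀ i, Quotient.mk (NSetoid hp _) (ν i) = a i) ∧ p (Sen.rel r ν) = true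

def NMod.mk {p : Sen M S0 → Bool} (hp : p ∈ X0 M S0) {s : σ.Sorts} (c : Nm M S0 s) :
    (NMod hp).dom s := Quotient.mk (NSetoid hp s) c

theorem NMod.mk_eq {p : Sen M S0 → Bool} (hp : p ∈ X0 M S0) {s : σ.Sorts} (c c' : Nm M S0 s) :
    NMod.mk hp c = NMod.mk hp c' ↔ p (Sen.eq c c') = true :=
  ⟨fun h => Quotient.exact (s := NSetoid hp s) h, fun h => Quotient.sound (s := NSetoid hp s) h⟩

theorem NMod.mk_surj {p : Sen M S0 → Bool} (hp : p ∈ X0 M S0) {s : σ.Sorts} (x : (NMod hp).dom s) :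
    ∃ c : Nm M S0 s, NMod.mk hp c = x := Quotient.exists_rep (s := NSetoid hp s) x

theorem NMod.rel_iff {p : Sen M S0 → Bool} (hp : p ∈ X0 M S0) (r : σ.Rels)
    (ν : (i : Fin (σ.arity r).length) → Nm M S0 ((σ.arity r).get i)) :
    (NMod hp).rel r (fun i => NMod.mk hp (ν i)) ↔ p (Sen.rel r ν) = true := by
  constructor
  · rintro ⟨ν', h1, h2⟩
    rw [← h2]
    refine X0.congr hp _ ν ν' fun i => ?_
    exact (NMod.mk_eq hp _ _).1 (h1 i).symm
  · intro h
    exact ⟨ν, fun i => rfl, h⟩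

def NMod.env {p : Sen M S0 → Bool} (hp : p ∈ X0 M S0) {Γ : List σ.Sorts} (ν : MEnv (NmS M S0) Γ) :
    MEnv (NMod hp) Γ := fun i => NMod.mk hp (ν i)

theorem NMod.env_cons {p : Sen M S0 → Bool} (hp : p ∈ X0 M S0) {Γ : List σ.Sorts}
    {s : σ.Sorts} (n : Nm M S0 s) (ν : MEnv (NmS M S0) Γ) :
    NMod.env hp (MEnv.cons (M := NmS M S0) n ν) = MEnv.cons (NMod.mk hp n) (NMod.env hp ν) := by
  funext i
  refine Fin.cases ?_ ?_ i
  · rfl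
  · intro j; rfl

theorem NMod.val_env {p : Sen M S0 → Bool} (hp : p ∈ X0 M S0) {Γ : List σ.Sorts} {s : σ.Sorts}
    (v : MVar Γ s) (ν : MEnv (NmS M S0) Γ) :
    v.val (NMod.env hp ν) = NMod.mk hp (s := s) (v.val ν) := by
  obtain ⟨i, rfl⟩ := v
  rfl

theorem NMod.truth {p : Sen M S0 → Bool} (hp : p ∈ X0 M S0) (hH : Henkin p) {Γ : List σ.Sorts}
    (φ : MForm σ Γ) : ∀ ν : MEnv (NmS M S0) Γ, φ.Sat (NMod.env hp ν) ↔ p ⟨Γ, φ, ν⟩ = true := by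
  induction φ with
  | @rel Γ r args =>
    intro ν
    simp only [MForm.Sat, NMod.val_env]
    rw [NMod.rel_iff]
    obtain ⟨e, he⟩ := X0.fin_sat hp (Set.toFinite {Sen.rel r (fun i => (args i).val ν),
      (⟨Γ, .rel r args, ν⟩ : Sen M S0)})
    rw [← he _ (Or.inl rfl), ← he _ (Or.inr rfl), tv_rel, tv_iff]
    simp only [MForm.Sat, MVal.val_env]
  | @eq Γ s v w =>
    intro ν
    simp only [MForm.Sat, NMod.val_env]
    rw [NMod.mk_eq]
    obtain ⟨e, he⟩ := X0.fin_sat hp (Set.toFinite {Sen.eq (s := s) (v.val ν) (w.val ν),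
      (⟨Γ, .eq v w, ν⟩ : Sen M S0)})
    rw [← he _ (Or.inl rfl), ← he _ (Or.inr rfl), tv_eq, tv_iff]
    simp only [MForm.Sat, MVal.val_env]
  | @fal Γ =>
    intro ν
    obtain ⟨e, he⟩ := X0.fin_sat hp (Set.toFinite {(⟨Γ, .fal, ν⟩ : Sen M S0)})
    rw [← he _ rfl, tv_iff]
    simp only [MForm.Sat]
  | @imp Γ φ ψ ih1 ih2 =>
    intro ν
    simp only [MForm.Sat, ih1, ih2]
    obtain ⟨e, he⟩ := X0.fin_sat hp (Set.toFinite {(⟨Γ, φ, ν⟩ : Sen M S0), ⟨Γ, ψ, ν⟩, ⟨Γ, .imp φ ψ, ν⟩})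
    rw [← he ⟨Γ, φ, ν⟩ (by simp), ← he ⟨Γ, ψ, ν⟩ (by simp), ← he ⟨Γ, .imp φ ψ, ν⟩ (by simp),
      tv_iff, tv_iff, tv_iff]
    simp only [MForm.Sat]
  | @all Γ s φ ih =>
    intro ν
    simp only [MForm.Sat]
    constructor
    · intro h
      by_contra h'
      obtain ⟨n, hn⟩ := hH Γ s φ ν (by simpa using h')
      have := h (NMod.mk hp n)
      rw [← NMod.env_cons, ih, hn] at this
      exact absurd this (by simp)
    · intro h x
      obtain ⟨n, rfl⟩ := NMod.mk_surj hp x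
      rw [← NMod.env_cons, ih]
      obtain ⟨e, he⟩ := X0.fin_sat hp (Set.toFinite {(⟨Γ, .all s φ, ν⟩ : Sen M S0),
        ⟨s :: Γ, φ, MEnv.cons (M := NmS M S0) n ν⟩})
      rw [← he _ (Or.inl rfl), tv_iff] at h
      rw [← he _ (Or.inr rfl), tv_iff, MVal.env_cons]
      exact h _

theorem NMod.models {p : Sen M S0 → Bool} (hp : p ∈ X0 M S0) (hH : Henkin p)
    {T : Set (MForm σ [])} (hM : M.Models T) : (NMod hp).Models T := by
  intro φ hφ
  have h0 : (MEnv.nil : MEnv (NMod hp) []) = NMod.env hp MEnv.nil := by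
    funext i; exact i.elim0
  rw [h0, NMod.truth hp hH]
  obtain ⟨e, he⟩ := X0.fin_sat hp (Set.finite_singleton (⟨[], φ, MEnv.nil⟩ : Sen M S0))
  rw [← he _ rfl, tv_iff]
  have h1 : (e.env MEnv.nil : MEnv M []) = MEnv.nil := by
    funext i; exact i.elim0
  rw [h1]
  exact hM φ hφ

/-- The identification of the `S0`-parts. -/
noncomputable def NMod.f {p : Sen M S0 → Bool} (hp : p ∈ X0 M S0) (s : σ.Sorts) (hs : s ∈ S0) :
    (NMod hp).dom s → M.dom s :=
  Quotient.lift (s := NSetoid hp s) ((Classical.arbitrary (MVal M S0)).e s) (by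
    intro c c' h
    obtain ⟨e, he⟩ := X0.fin_sat hp (Set.finite_singleton (Sen.eq c c'))
    have h' : p (Sen.eq c c') = true := h
    rw [← he _ rfl, tv_eq] at h'
    rw [MVal.eq_of_mem _ e hs c, h', MVal.eq_of_mem e _ hs c'])

theorem NMod.f_mk {p : Sen M S0 → Bool} (hp : p ∈ X0 M S0) (s : σ.Sorts) (hs : s ∈ S0)
    (c : Nm M S0 s) (e : MVal M S0) : NMod.f hp s hs (NMod.mk hp c) = e.e s c :=
  MVal.eq_of_mem _ e hs c

theorem NMod.f_bij {p : Sen M S0 → Bool} (hp : p ∈ X0 M S0) (s : σ.Sorts) (hs : s ∈ S0) :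
    Function.Bijective (NMod.f hp s hs) := by
  constructor
  · intro x y h
    obtain ⟨c, rfl⟩ := NMod.mk_surj hp x
    obtain ⟨c', rfl⟩ := NMod.mk_surj hp y
    rw [NMod.mk_eq]
    obtain ⟨e, he⟩ := X0.fin_sat hp (Set.finite_singleton (Sen.eq c c'))
    rw [← he _ rfl, tv_eq, ← NMod.f_mk hp s hs, ← NMod.f_mk hp s hs, h]
  · intro m
    obtain ⟨e⟩ : Nonempty (MVal M S0) := inferInstance
    exact ⟨NMod.mk hp (.par hs m), by rw [NMod.f_mk hp s hs _ e, e.epar]⟩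

theorem NMod.f_rel {p : Sen M S0 → Bool} (hp : p ∈ X0 M S0) (r : σ.Rels) (hr : RelOver S0 r)
    (a : (i : Fin (σ.arity r).length) → (NMod hp).dom ((σ.arity r).get i)) :
    (NMod hp).rel r a ↔ M.rel r (fun i => NMod.f hp _ (hr i) (a i)) := by
  choose ν hν using fun i => NMod.mk_surj hp (a i)
  obtain rfl : (fun i => NMod.mk hp (ν i)) = a := funext hν
  rw [NMod.rel_iff]
  obtain ⟨e, he⟩ := X0.fin_sat hp (Set.finite_singleton (Sen.rel r ν))
  rw [← he _ rfl, tv_rel]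
  simp only [NMod.f_mk hp _ _ _ e]

end Names
section Generic

variable {M : MStr σ} {S0 : Set σ.Sorts}

/-- Names of the sorts in `S1`. -/
abbrev NJ (M : MStr σ) (S0 S1 : Set σ.Sorts) : Type := Σ s : {s // s ∈ S1}, Nm M S0 s.1

/-- Homomorphisms from the term model to `M`, on the level of names. -/
structure NHom (S1 : Set σ.Sorts) (p : Sen M S0 → Bool) (g : ∀ j : NJ M S0 S1, M.dom j.1.1) :
    Prop where
  par : ∀ (s : σ.Sorts) (h1 : s ∈ S1) (h0 : s ∈ S0) (m : M.dom s), g ⟨⟨s, h1⟩, .par h0 m⟩ = m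
  eq : ∀ (s : σ.Sorts) (h1 : s ∈ S1) (c c' : Nm M S0 s), p (Sen.eq c c') = true →
    g ⟨⟨s, h1⟩, c⟩ = g ⟨⟨s, h1⟩, c'⟩
  rel : ∀ (r : σ.Rels) (hr : RelOver S1 r)
    (ν : (i : Fin (σ.arity r).length) → Nm M S0 ((σ.arity r).get i)),
    p (Sen.rel r ν) = true → M.rel r (fun i => g ⟨⟨_, hr i⟩, ν i⟩)

section
variable {T : Set (MForm σ [])} {S1 : Set σ.Sorts} {h01 : S0 ⊆ S1}

theorem NHom.unique (himp : ImplInterp T S0 S1 h01) (hM : M.Models T) {p : Sen M S0 → Bool}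
    (hp : p ∈ XH M S0) {g g' : ∀ j : NJ M S0 S1, M.dom j.1.1} (hg : NHom S1 p g)
    (hg' : NHom S1 p g') : g = g' := by
  obtain ⟨hp, hH⟩ := hp
  obtain ⟨k, -, hk⟩ := himp (NMod hp) M (NMod.models hp hH hM) hM (NMod.f hp) (NMod.f_bij hp)
    (NMod.f_rel hp)
  have key : ∀ g : ∀ j : NJ M S0 S1, M.dom j.1.1, NHom S1 p g →
      ∀ s (hs : s ∈ S1) c, k s hs (NMod.mk hp c) = g ⟨⟨s, hs⟩, c⟩ := by
    intro g hg
    have := hk (fun s hs => Quotient.lift (s := NSetoid hp s) (fun c => g ⟨⟨s, hs⟩, c⟩)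
      (fun c c' h => hg.eq s hs c c' h)) ⟨?_, ?_⟩
    · intro s hs c
      rw [← this]
      rfl
    · intro s hs
      funext x
      obtain ⟨c, rfl⟩ := NMod.mk_surj hp x
      cases c with
      | par h m =>
        obtain ⟨e⟩ : Nonempty (MVal M S0) := inferInstance
        rw [NMod.f_mk hp s hs _ e, e.epar]
        exact hg.par s (h01 hs) h m
      | var h _ _ => exact absurd hs h
    · intro r hr a ha
      choose ν hν using fun i => NMod.mk_surj hp (a i)
      obtain rfl : (fun i => NMod.mk hp (ν i)) = a := funext hν
      rw [NMod.rel_iff] at ha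
      exact hg.rel r hr ν ha
  funext ⟨⟨s, hs⟩, c⟩
  rw [← key g hg, ← key g' hg']

theorem NHom.exists (himp : ImplInterp T S0 S1 h01) (hM : M.Models T) {p : Sen M S0 → Bool}
    (hp : p ∈ XH M S0) : ∃ g : ∀ j : NJ M S0 S1, M.dom j.1.1, NHom S1 p g ∧
      ∀ (s : σ.Sorts) (h1 : s ∈ S1) (c c' : Nm M S0 s),
        g ⟨⟨s, h1⟩, c⟩ = g ⟨⟨s, h1⟩, c'⟩ → p (Sen.eq c c') = true := by
  obtain ⟨hp, hH⟩ := hp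
  obtain ⟨g, g', h1, h2, h3, h4, h5⟩ := twoway himp (NMod hp) M (NMod.models hp hH hM) hM
    (NMod.f hp) (NMod.f_bij hp) (NMod.f_rel hp)
  refine ⟨fun j => g j.1.1 j.1.2 (NMod.mk hp j.2), ⟨?_, ?_, ?_⟩, ?_⟩
  · intro s hs1 h0 m
    have := h1 s h0
    show g s hs1 (NMod.mk hp (.par h0 m)) = m
    rw [this]
    obtain ⟨e⟩ : Nonempty (MVal M S0) := inferInstance
    rw [NMod.f_mk hp s h0 _ e, e.epar]
  · intro s hs c c' h
    show g s hs (NMod.mk hp c) = g s hs (NMod.mk hp c')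
    rw [(NMod.mk_eq hp c c').2 h]
  · intro r hr ν h
    exact h2 r hr _ ((NMod.rel_iff hp r ν).2 h)
  · intro s hs c c' h
    have h : g s hs (NMod.mk hp c) = g s hs (NMod.mk hp c') := h
    rw [← NMod.mk_eq hp, ← h5 s hs (NMod.mk hp c), h, h5]

end

/-- Index of a name. -/
def Nm.idx {s : σ.Sorts} : Nm M S0 s → ℕ
  | .par _ _ => 0
  | .var _ _ n => n

theorem Sen.bound (t : Sen M S0) : ∃ K, ∀ i, Nm.idx (s := t.ctx.get i) (t.nu i) < K := by
  refine ⟨Finset.univ.sup (fun i => Nm.idx (s := t.ctx.get i) (t.nu i)) + 1, fun i => ?_⟩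
  exact Nat.lt_succ_of_le
    (Finset.le_sup (f := fun i => Nm.idx (s := t.ctx.get i) (t.nu i)) (Finset.mem_univ i))

theorem tv_congr {e e' : MVal M S0} {t : Sen M S0} {K : ℕ}
    (hK : ∀ i, Nm.idx (s := t.ctx.get i) (t.nu i) < K)
    (h : ∀ s (c : Nm M S0 s), c.idx < K → e'.e s c = e.e s c) : tv e' t = tv e t := by
  obtain ⟨Γ, φ, ν⟩ := t
  have : e'.env ν = e.env ν := by
    funext i
    exact h _ _ (hK i)
  rw [Bool.eq_iff_iff, tv_iff, tv_iff, this]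

theorem tv_open {U : Set (Sen M S0 → Bool)} (hU : IsOpen U) {e : MVal M S0} (he : tv e ∈ U) :
    ∃ K, ∀ e' : MVal M S0, (∀ s (c : Nm M S0 s), c.idx < K → e'.e s c = e.e s c) → tv e' ∈ U := by
  obtain ⟨F, hF⟩ := open_fin hU he
  choose K hK using Sen.bound (M := M) (S0 := S0)
  refine ⟨F.sup K, fun e' h => hF _ fun t ht => ?_⟩
  exact tv_congr (hK t) fun s c hc => h s c (hc.trans_le (Finset.le_sup ht))

open Classical in
/-- Updating a valuation at a variable. -/
noncomputable def MVal.upd (e : MVal M S0) {s : σ.Sorts} (hs : s ∉ S0) (hne : Nonempty (M.dom s))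
    (n : ℕ) (x : M.dom s) : MVal M S0 where
  e := Function.update e.e s (Function.update (e.e s) (.var hs hne n) x)
  epar s' hs' m := by
    have : s' ≠ s := fun h => hs (h ▸ hs')
    rw [Function.update_of_ne this, e.epar]

theorem MVal.upd_self (e : MVal M S0) {s : σ.Sorts} (hs : s ∉ S0) (hne : Nonempty (M.dom s))
    (n : ℕ) (x : M.dom s) : (e.upd hs hne n x).e s (.var hs hne n) = x := by
  simp [MVal.upd]

theorem MVal.upd_of_ne (e : MVal M S0) {s : σ.Sorts} (hs : s ∉ S0) (hne : Nonempty (M.dom s))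
    (n : ℕ) (x : M.dom s) {s' : σ.Sorts} (c : Nm M S0 s')
    (h : (⟨s', c⟩ : Σ s, Nm M S0 s) ≠ ⟨s, .var hs hne n⟩) :
    (e.upd hs hne n x).e s' c = e.e s' c := by
  by_cases hs' : s' = s
  · subst hs'
    have : c ≠ .var hs hne n := fun h' => h (by rw [h'])
    simp [MVal.upd, this]
  · simp [MVal.upd, hs']

variable (M S0) in
theorem isCompact_X0 : CompactSpace (X0 M S0) :=
  isCompact_iff_compactSpace.1 isClosed_closure.isCompact

theorem tv_mem (e : MVal M S0) : tv e ∈ X0 M S0 := subset_closure ⟨e, rfl⟩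

theorem X0.open_has {O : Set (X0 M S0)} (hO : IsOpen O) (hne : O.Nonempty) :
    ∃ e : MVal M S0, (⟨tv e, tv_mem e⟩ : X0 M S0) ∈ O := by
  obtain ⟨U, hU, rfl⟩ := isOpen_induced_iff.1 hO
  obtain ⟨⟨p, hp⟩, hpU⟩ := hne
  exact X0.open_sat hp hU hpU

def HenkinAt (Γ : List σ.Sorts) (s : σ.Sorts) (φ : MForm σ (s :: Γ)) (ν : MEnv (NmS M S0) Γ) :
    Set (Sen M S0 → Bool) :=
  {p | p ⟨Γ, .all s φ, ν⟩ = true} ∪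
    ⋃ n : Nm M S0 s, {p | p ⟨s :: Γ, φ, MEnv.cons (M := NmS M S0) n ν⟩ = false}

theorem HenkinAt.isOpen (Γ : List σ.Sorts) (s : σ.Sorts) (φ : MForm σ (s :: Γ))
    (ν : MEnv (NmS M S0) Γ) : IsOpen (HenkinAt Γ s φ ν) :=
  (isOpen_coord _ _).union (isOpen_iUnion fun _ => isOpen_coord _ _)

theorem HenkinAt.dense (Γ : List σ.Sorts) (s : σ.Sorts) (φ : MForm σ (s :: Γ))
    (ν : MEnv (NmS M S0) Γ) : Dense ((↑) ⁻¹' HenkinAt Γ s φ ν : Set (X0 M S0)) := by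
  rw [dense_iff_inter_open]
  intro O hO hne
  obtain ⟨e, he⟩ := X0.open_has hO hne
  obtain ⟨U, hU, rfl⟩ := isOpen_induced_iff.1 hO
  have he : tv e ∈ U := he
  by_cases hall : tv e ⟨Γ, .all s φ, ν⟩ = true
  · exact ⟨⟨tv e, tv_mem e⟩, he, Or.inl hall⟩
  · rw [tv_iff] at hall
    simp only [MForm.Sat, not_forall] at hall
    obtain ⟨x, hx⟩ := hall
    by_cases hs : s ∈ S0
    · refine ⟨⟨tv e, tv_mem e⟩, he, Or.inr (Set.mem_iUnion.2 ⟨.par hs x, ?_⟩)⟩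
      show tv e _ = false
      rw [← Bool.not_eq_true, tv_iff, MVal.env_cons, e.epar]
      exact hx
    · obtain ⟨K, hK⟩ := tv_open hU he
      obtain ⟨K', hK'⟩ := Sen.bound (⟨Γ, .all s φ, ν⟩ : Sen M S0)
      have hne : Nonempty (M.dom s) := ⟨x⟩
      have hag : ∀ s' (c : Nm M S0 s'), c.idx < max K K' →
          (e.upd hs hne (max K K') x).e s' c = e.e s' c := by
        intro s' c hc
        refine MVal.upd_of_ne _ _ _ _ _ _ fun h => ?_
        obtain ⟨rfl, h⟩ := Sigma.mk.inj_iff.1 h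
        rw [eq_of_heq h] at hc
        exact absurd hc (lt_irrefl _)
      refine ⟨⟨tv (e.upd hs hne (max K K') x), tv_mem _⟩,
        hK _ fun s' c hc => hag s' c (lt_max_of_lt_left hc), ?_⟩
      refine Or.inr (Set.mem_iUnion.2 ⟨.var hs hne (max K K'), ?_⟩)
      show tv _ _ = false
      rw [← Bool.not_eq_true, tv_iff, MVal.env_cons, MVal.upd_self]
      have : (e.upd hs hne (max K K') x).env ν = e.env ν := by
        funext i
        exact hag _ _ (lt_max_of_lt_right (hK' i))
      rw [this]
      exact hx

theorem XH_eq : XH M S0 = X0 M S0 ∩ ⋂ q : (Σ Γ : List σ.Sorts, Σ s : σ.Sorts,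
    MForm σ (s :: Γ) × MEnv (NmS M S0) Γ), HenkinAt q.1 q.2.1 q.2.2.1 q.2.2.2 := by
  ext p
  constructor
  · rintro ⟨h1, h2⟩
    refine ⟨h1, Set.mem_iInter.2 ?_⟩
    rintro ⟨Γ, s, φ, ν⟩
    by_cases h : p ⟨Γ, .all s φ, ν⟩ = true
    · exact Or.inl h
    · exact Or.inr (Set.mem_iUnion.2 (h2 Γ s φ ν (by simpa using h)))
  · rintro ⟨h1, h2⟩
    refine ⟨h1, ?_⟩
    intro Γ s φ ν h
    rcases Set.mem_iInter.1 h2 ⟨Γ, s, φ, ν⟩ with h' | h'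
    · have h' : p ⟨Γ, .all s φ, ν⟩ = true := h'
      rw [h] at h'
      exact absurd h' (by simp)
    · obtain ⟨n, hn⟩ := Set.mem_iUnion.1 h'
      exact ⟨n, hn⟩

variable (M S0) in
theorem henkinIdx_countable [Countable σ.Sorts] [Countable σ.Rels] [∀ s, Countable (M.dom s)] :
    Countable (Σ Γ : List σ.Sorts, Σ s : σ.Sorts, MForm σ (s :: Γ) × MEnv (NmS M S0) Γ) := by
  have : ∀ s, Countable ((NmS M S0).dom s) := fun s => Nm.countable M S0 s
  have : ∀ Γ, Countable (MEnv (NmS M S0) Γ) := fun Γ =>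
    inferInstanceAs (Countable ((i : Fin Γ.length) → (NmS M S0).dom (Γ.get i)))
  infer_instance

variable (M S0) in
theorem XH_residual [Countable σ.Sorts] [Countable σ.Rels] [∀ s, Countable (M.dom s)] :
    ((↑) ⁻¹' XH M S0 : Set (X0 M S0)) ∈ residual (X0 M S0) := by
  have := henkinIdx_countable M S0
  have h : ((↑) ⁻¹' XH M S0 : Set (X0 M S0)) = ⋂ q : (Σ Γ : List σ.Sorts, Σ s : σ.Sorts,
    MForm σ (s :: Γ) × MEnv (NmS M S0) Γ),
      ((↑) ⁻¹' HenkinAt q.1 q.2.1 q.2.2.1 q.2.2.2 : Set (X0 M S0)) := by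
    rw [XH_eq]
    ext p
    simp
  rw [h, countable_iInter_mem]
  intro q
  exact residual_of_dense_open ((HenkinAt.isOpen _ _ _ _).preimage continuous_subtype_val)
    (HenkinAt.dense _ _ _ _)

/-- The set of theories whose homomorphism sends the name `j` to `b`. -/
def BSet (S1 : Set σ.Sorts) (j : NJ M S0 S1) (b : M.dom j.1.1) : Set (Sen M S0 → Bool) :=
  {p | p ∈ XH M S0 ∧ ∃ g : ∀ j : NJ M S0 S1, M.dom j.1.1, NHom S1 p g ∧ g j = b}

theorem BSet.meas [Countable σ.Sorts] [Countable σ.Rels] [∀ s, Countable (M.dom s)]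
    {T : Set (MForm σ [])} {S1 : Set σ.Sorts} {h01 : S0 ⊆ S1}
    (himp : ImplInterp T S0 S1 h01) (hM : M.Models T) (j : NJ M S0 S1) (b : M.dom j.1.1) :
    @MeasurableSet _ (borel _) (BSet S1 j b) := by
  have := Sen.countable M S0
  have := henkinIdx_countable M S0
  have hNm : ∀ s, Countable (Nm M S0 s) := fun s => Nm.countable M S0 s
  let _ : ∀ j : NJ M S0 S1, TopologicalSpace (M.dom j.1.1) := fun _ => ⊥
  have : ∀ j : NJ M S0 S1, DiscreteTopology (M.dom j.1.1) := fun _ => ⟨rfl⟩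
  have : Countable (NJ M S0 S1) := inferInstance
  have hP : ∀ j : NJ M S0 S1, PolishSpace (M.dom j.1.1) := fun j => inferInstance
  have : PolishSpace (∀ j : NJ M S0 S1, M.dom j.1.1) := inferInstance
  have hPB : PolishSpace Bool := inferInstance
  have : PolishSpace (Sen M S0 → Bool) :=
    inferInstanceAs (PolishSpace (∀ s : Sen M S0, (fun _ : Sen M S0 => Bool) s))
  let G := ∀ j : NJ M S0 S1, M.dom j.1.1
  have : PolishSpace ((Sen M S0 → Bool) × G) := inferInstance
  let _ : MeasurableSpace (Sen M S0 → Bool) := borel _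
  have : BorelSpace (Sen M S0 → Bool) := ⟨rfl⟩
  let _ : MeasurableSpace ((Sen M S0 → Bool) × G) := borel _
  have : BorelSpace ((Sen M S0 → Bool) × G) := ⟨rfl⟩
  let Z : Set ((Sen M S0 → Bool) × G) := {q | q.1 ∈ XH M S0 ∧ NHom S1 q.1 q.2 ∧ q.2 j = b}
  have hZ : BSet S1 j b = Prod.fst '' Z := by
    ext p
    constructor
    · rintro ⟨h1, g, h2, h3⟩
      exact ⟨(p, g), ⟨h1, h2, h3⟩, rfl⟩
    · rintro ⟨⟨p, g⟩, ⟨h1, h2, h3⟩, rfl⟩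
      exact ⟨h1, g, h2, h3⟩
  rw [hZ]
  refine MeasurableSet.image_of_continuousOn_injOn ?_ continuous_fst.continuousOn ?_
  · have c1 : ∀ t, Continuous (fun q : (Sen M S0 → Bool) × G => q.1 t) := fun t =>
      (continuous_apply t).comp continuous_fst
    have c2 : ∀ j, Continuous (fun q : (Sen M S0 → Bool) × G => q.2 j) := fun j =>
      (continuous_apply j).comp continuous_snd
    have hXH : MeasurableSet (XH M S0) := by
      rw [XH_eq]
      exact isClosed_closure.measurableSet.inter
        (MeasurableSet.iInter fun q => (HenkinAt.isOpen _ _ _ _).measurableSet)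
    have m1 : MeasurableSet {q : (Sen M S0 → Bool) × G | q.1 ∈ XH M S0} :=
      continuous_fst.measurable hXH
    have m2 : ∀ t, MeasurableSet {q : (Sen M S0 → Bool) × G | q.1 t = true} := fun t =>
      ((isOpen_discrete ({true} : Set Bool)).preimage (c1 t)).measurableSet
    have m3 : ∀ (j : NJ M S0 S1) (x : M.dom j.1.1),
        MeasurableSet {q : (Sen M S0 → Bool) × G | q.2 j = x} := fun j x =>
      ((isOpen_discrete ({x} : Set (M.dom j.1.1))).preimage (c2 j)).measurableSet
    have m4 : ∀ (s : {s // s ∈ S1}) (c c' : Nm M S0 s.1),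
        MeasurableSet {q : (Sen M S0 → Bool) × G | q.2 ⟨s, c⟩ = q.2 ⟨s, c'⟩} := by
      intro s c c'
      exact (isClosed_eq (c2 ⟨s, c⟩) (c2 ⟨s, c'⟩)).measurableSet
    have m5 : ∀ (r : σ.Rels) (hr : RelOver S1 r)
        (ν : (i : Fin (σ.arity r).length) → Nm M S0 ((σ.arity r).get i)),
        MeasurableSet {q : (Sen M S0 → Bool) × G |
          M.rel r (fun i => q.2 ⟨⟨_, hr i⟩, ν i⟩)} := by
      intro r hr ν
      let _ : ∀ i, TopologicalSpace (M.dom ((σ.arity r).get i)) := fun i => ⊥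
      have : ∀ i, DiscreteTopology (M.dom ((σ.arity r).get i)) := fun i => ⟨rfl⟩
      have cc : Continuous (fun q : (Sen M S0 → Bool) × G =>
          fun i : Fin (σ.arity r).length => q.2 ⟨⟨_, hr i⟩, ν i⟩) :=
        continuous_pi fun i => c2 ⟨⟨_, hr i⟩, ν i⟩
      exact ((isOpen_discrete {a | M.rel r a}).preimage cc).measurableSet
    have hZ' : Z = {q : (Sen M S0 → Bool) × G | q.1 ∈ XH M S0} ∩
        ((⋂ k : (Σ s : {s : σ.Sorts // s ∈ S1 ∧ s ∈ S0}, M.dom s.1),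
            {q | q.2 ⟨⟨k.1.1, k.1.2.1⟩, .par k.1.2.2 k.2⟩ = k.2}) ∩
          (⋂ k : (Σ s : {s // s ∈ S1}, Nm M S0 s.1 × Nm M S0 s.1),
            ({q | q.1 (Sen.eq k.2.1 k.2.2) = true}ᶜ ∪ {q | q.2 ⟨k.1, k.2.1⟩ = q.2 ⟨k.1, k.2.2⟩})) ∩
          (⋂ k : (Σ r : {r // RelOver S1 r},
              ((i : Fin (σ.arity r.1).length) → Nm M S0 ((σ.arity r.1).get i))),
            ({q | q.1 (Sen.rel k.1.1 k.2) = true}ᶜ ∪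
              {q | M.rel k.1.1 (fun i => q.2 ⟨⟨_, k.1.2 i⟩, k.2 i⟩)}))) ∩
        {q | q.2 j = b} := by
      ext ⟨p, g⟩
      constructor
      · rintro ⟨h1, h2, h3⟩
        refine ⟨⟨h1, ⟨?_, ?_⟩, ?_⟩, h3⟩
        · exact Set.mem_iInter.2 fun k => h2.par _ _ _ _
        · exact Set.mem_iInter.2 fun k => Classical.or_iff_not_imp_left.2 fun h =>
            h2.eq _ _ _ _ (not_not.1 h)
        · exact Set.mem_iInter.2 fun k => Classical.or_iff_not_imp_left.2 fun h =>
            h2.rel _ _ _ (not_not.1 h)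
      · rintro ⟨⟨h1, ⟨h4, h5⟩, h6⟩, h3⟩
        refine ⟨h1, ⟨?_, ?_, ?_⟩, h3⟩
        · intro s hs1 hs0 m
          exact Set.mem_iInter.1 h4 ⟨⟨s, hs1, hs0⟩, m⟩
        · intro s hs1 c c' h
          exact (Set.mem_iInter.1 h5 ⟨⟨s, hs1⟩, c, c'⟩).resolve_left (fun h' => h' h)
        · intro r hr ν h
          exact (Set.mem_iInter.1 h6 ⟨⟨r, hr⟩, ν⟩).resolve_left (fun h' => h' h)
    rw [hZ']
    refine (m1.inter (((MeasurableSet.iInter fun k => m3 _ _).inter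
      (MeasurableSet.iInter fun k => (m2 _).compl.union (m4 _ _ _))).inter
      (MeasurableSet.iInter fun k => (m2 _).compl.union (m5 _ _ _)))).inter (m3 _ _)
  · rintro ⟨p, g⟩ ⟨h1, h2, h3⟩ ⟨p', g'⟩ ⟨h1', h2', h3'⟩ h
    obtain rfl : p = p' := h
    have : g = g' := NHom.unique himp hM h1 h2 h2'
    rw [this]

end Generic

section Pin

variable {M : MStr σ} {S0 : Set σ.Sorts}

/-- Involution swapping the first two blocks of length `K`. -/
def swapN (K n : ℕ) : ℕ := if n < K then n + K else if n < 2 * K then n - K else n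

theorem swapN_swapN (K n : ℕ) : swapN K (swapN K n) = n := by
  unfold swapN
  split_ifs <;> omega

def Nm.swap (K : ℕ) {s : σ.Sorts} : Nm M S0 s → Nm M S0 s
  | .par hs m => .par hs m
  | .var hs hne n => .var hs hne (swapN K n)

theorem Nm.swap_swap (K : ℕ) {s : σ.Sorts} (c : Nm M S0 s) : (c.swap K).swap K = c := by
  cases c with
  | par hs m => rfl
  | var hs hne n => simp [Nm.swap, swapN_swapN]

def Sen.map (K : ℕ) (t : Sen M S0) : Sen M S0 :=
  ⟨t.ctx, t.form, fun i => Nm.swap K (s := t.ctx.get i) (t.nu i)⟩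

theorem Sen.map_map (K : ℕ) (t : Sen M S0) : (t.map K).map K = t := by
  obtain ⟨Γ, φ, ν⟩ := t
  simp only [Sen.map]
  congr 1
  funext i
  exact Nm.swap_swap K (s := Γ.get i) (ν i)

theorem Sen.map_eq (K : ℕ) {s : σ.Sorts} (c c' : Nm M S0 s) :
    (Sen.eq c c').map K = Sen.eq (c.swap K) (c'.swap K) := by
  simp only [Sen.map, Sen.eq]
  congr 1
  funext i
  refine Fin.cases rfl (fun j => ?_) i
  refine Fin.cases rfl (fun k => k.elim0) j

theorem Sen.map_rel (K : ℕ) (r : σ.Rels)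
    (ν : (i : Fin (σ.arity r).length) → Nm M S0 ((σ.arity r).get i)) :
    (Sen.rel r ν).map K = Sen.rel r (fun i => (ν i).swap K) := rfl

def piS (K : ℕ) (p : Sen M S0 → Bool) : Sen M S0 → Bool := fun t => p (t.map K)

def MVal.swap (K : ℕ) (e : MVal M S0) : MVal M S0 where
  e s c := e.e s (c.swap K)
  epar s hs m := e.epar s hs m

theorem piS_tv (K : ℕ) (e : MVal M S0) : piS K (tv e) = tv (e.swap K) := by
  funext ⟨Γ, φ, ν⟩
  rfl

theorem piS_continuous (K : ℕ) : Continuous (piS K : (Sen M S0 → Bool) → _) :=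
  continuous_pi fun t => continuous_apply (A := fun _ : Sen M S0 => Bool) (t.map K)

theorem piS_piS (K : ℕ) (p : Sen M S0 → Bool) : piS K (piS K p) = p := by
  funext t
  simp only [piS, Sen.map_map]

theorem piS_mem (K : ℕ) {p : Sen M S0 → Bool} (hp : p ∈ X0 M S0) : piS K p ∈ X0 M S0 := by
  refine map_mem_closure (piS_continuous K) hp ?_
  rintro _ ⟨e, rfl⟩
  exact ⟨e.swap K, (piS_tv K e).symm⟩

variable (M S0) in
/-- The homeomorphism of the space of theories induced by a permutation of the names. -/
def piH (K : ℕ) : X0 M S0 ≃ₜ X0 M S0 where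
  toFun p := ⟨piS K p.1, piS_mem K p.2⟩
  invFun p := ⟨piS K p.1, piS_mem K p.2⟩
  left_inv p := Subtype.ext (piS_piS K p.1)
  right_inv p := Subtype.ext (piS_piS K p.1)
  continuous_toFun := ((piS_continuous K).comp continuous_subtype_val).subtype_mk _
  continuous_invFun := ((piS_continuous K).comp continuous_subtype_val).subtype_mk _

theorem NHom.swap (K : ℕ) {S1 : Set σ.Sorts} {p : Sen M S0 → Bool}
    {g : ∀ j : NJ M S0 S1, M.dom j.1.1} (h : NHom S1 (piS K p) g) :
    NHom S1 p (fun j => g ⟨j.1, j.2.swap K⟩) where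
  par s h1 h0 m := h.par s h1 h0 m
  eq s h1 c c' hc := by
    refine h.eq s h1 _ _ ?_
    rw [piS, Sen.map_eq, Nm.swap_swap, Nm.swap_swap]
    exact hc
  rel r hr ν hν := by
    refine h.rel r hr (fun i => (ν i).swap K) ?_
    rw [piS, ← Sen.map_rel, Sen.map_map]
    exact hν

/-- Glueing two valuations. -/
def MVal.glue (K : ℕ) (e1 e2 : MVal M S0) : MVal M S0 where
  e s c := if c.idx < K then e1.e s c else e2.e s (c.swap K)
  epar s hs m := by
    split_ifs
    · exact e1.epar s hs m
    · exact e2.epar s hs m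

theorem MVal.glue_left (K : ℕ) (e1 e2 : MVal M S0) (s : σ.Sorts) (c : Nm M S0 s)
    (h : c.idx < K) : (MVal.glue K e1 e2).e s c = e1.e s c := if_pos h

theorem MVal.glue_right (K : ℕ) (e1 e2 : MVal M S0) (s : σ.Sorts) (c : Nm M S0 s)
    (h : c.idx < K) : (MVal.glue K e1 e2).e s (c.swap K) = e2.e s c := by
  cases c with
  | par hs m => exact ((MVal.glue K e1 e2).epar s hs m).trans (e2.epar s hs m).symm
  | var hs hne n =>
    have h : n < K := h
    have h2 : ¬ (Nm.swap K (.var hs hne n : Nm M S0 s)).idx < K := by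
      simp [Nm.swap, Nm.idx, swapN, h]
    refine (if_neg h2).trans ?_
    rw [Nm.swap_swap]

theorem pin_dense [Countable σ.Sorts] [Countable σ.Rels] [∀ s, Countable (M.dom s)]
    {T : Set (MForm σ [])} {S1 : Set σ.Sorts} {h01 : S0 ⊆ S1}
    (himp : ImplInterp T S0 S1 h01) (hM : M.Models T) (j : NJ M S0 S1) :
    {p : X0 M S0 | ∃ (x : M.dom j.1.1) (U : Set (Sen M S0 → Bool)), IsOpen U ∧ p.1 ∈ U ∧
      ∀ e : MVal M S0, tv e ∈ U → e.e _ j.2 = x} ∈ residual (X0 M S0) := by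
  have := isCompact_X0 M S0
  refine residual_of_dense_open ?_ ?_
  · rw [isOpen_iff_forall_mem_open]
    rintro p ⟨x, U, hU, hpU, h⟩
    exact ⟨Subtype.val ⁻¹' U, fun q hq => ⟨x, U, hU, hq, h⟩, hU.preimage continuous_subtype_val, hpU⟩
  rw [dense_iff_inter_open]
  intro O hO hne
  have hB : ∃ b : M.dom j.1.1, ¬ IsMeagre (O ∩ (↑) ⁻¹' BSet S1 j b : Set (X0 M S0)) := by
    by_contra hcon
    push Not at hcon
    refine not_isMeagre_of_isOpen hO hne ?_
    have h1 : IsMeagre (((↑) ⁻¹' XH M S0 : Set (X0 M S0))ᶜ) := by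
      rw [IsMeagre, compl_compl]
      exact XH_residual M S0
    have h2 : IsMeagre (⋃ b, (O ∩ (↑) ⁻¹' BSet S1 j b : Set (X0 M S0))) :=
      isMeagre_iUnion hcon
    refine (h1.union h2).mono ?_
    intro p hp
    by_cases hpH : p.1 ∈ XH M S0
    · obtain ⟨g, hg, -⟩ := NHom.exists himp hM hpH
      exact Or.inr (Set.mem_iUnion.2 ⟨g j, hp, hpH, g, hg, rfl⟩)
    · exact Or.inl hpH
  obtain ⟨b, hb⟩ := hB
  let _ : MeasurableSpace (X0 M S0) := borel _
  have : BorelSpace (X0 M S0) := ⟨rfl⟩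
  have hmeas : MeasurableSet ((↑) ⁻¹' BSet S1 j b : Set (X0 M S0)) := by
    let _ : MeasurableSpace (Sen M S0 → Bool) := borel _
    have : BorelSpace (Sen M S0 → Bool) := ⟨rfl⟩
    exact continuous_subtype_val.measurable (BSet.meas himp hM j b)
  obtain ⟨W, hW, hBW⟩ := hmeas.residualEq_isOpen
  have hOW : (O ∩ W).Nonempty := by
    by_contra hcon
    rw [Set.not_nonempty_iff_eq_empty] at hcon
    refine hb ?_
    rw [IsMeagre]
    filter_upwards [hBW] with q hq
    intro hq'
    have : q ∈ W := (Eq.mp hq hq'.2)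
    have : q ∈ O ∩ W := ⟨hq'.1, this⟩
    rw [hcon] at this
    exact this
  have hOWo := hO.inter hW
  obtain ⟨e1, he1⟩ := X0.open_has hOWo hOW
  obtain ⟨U', hU', hU'e⟩ := isOpen_induced_iff.1 hOWo
  have hmem : ∀ p : X0 M S0, p.1 ∈ U' ↔ p ∈ O ∩ W := fun p => by rw [← hU'e]; rfl
  refine ⟨⟨tv e1, tv_mem e1⟩, he1.1, e1.e _ j.2, U', hU', (hmem _).2 he1, ?_⟩
  intro e2 he2
  by_contra hne12
  obtain ⟨K1, hK1⟩ := tv_open hU' ((hmem _).2 he1)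
  obtain ⟨K2, hK2⟩ := tv_open hU' he2
  obtain ⟨⟨s, hs⟩, c⟩ := j
  obtain ⟨K, hk1, hk2, hk3⟩ : ∃ K, K1 ≤ K ∧ K2 ≤ K ∧ c.idx < K :=
    ⟨max (max K1 K2) (c.idx + 1), by omega, by omega, by omega⟩
  set e := MVal.glue K e1 e2 with he
  have m1 : tv e ∈ U' := hK1 e fun s c hc => MVal.glue_left K e1 e2 s c (by omega)
  have m2 : piS K (tv e) ∈ U' := by
    rw [piS_tv]
    exact hK2 _ fun s c hc => MVal.glue_right K e1 e2 s c (by omega)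
  have m3 : tv e (Sen.eq c (c.swap K)) = false := by
    rw [← Bool.not_eq_true, tv_eq, he, MVal.glue_left K e1 e2 s c hk3,
      MVal.glue_right K e1 e2 s c hk3]
    exact fun h => hne12 h.symm
  have hgood : {q : X0 M S0 | q.1 ∈ XH M S0 ∧ (q ∈ W → q.1 ∈ BSet S1 ⟨⟨s, hs⟩, c⟩ b) ∧
      (piH M S0 K q ∈ W → (piH M S0 K q).1 ∈ BSet S1 ⟨⟨s, hs⟩, c⟩ b)} ∈ residual (X0 M S0) := by
    have ht := tendsto_residual_of_isOpenMap (piH M S0 K).continuous (piH M S0 K).isOpenMap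
    have hh : ∀ᶠ q in residual (X0 M S0), q ∈ W → q.1 ∈ BSet S1 ⟨⟨s, hs⟩, c⟩ b := by
      filter_upwards [hBW] with q hq h
      exact Eq.mpr hq h
    filter_upwards [XH_residual M S0, hh, ht.eventually hh] with q h1 h2 h3
    exact ⟨h1, h2, h3⟩
  have hopen : IsOpen {q : X0 M S0 | q.1 ∈ U' ∧ piS K q.1 ∈ U' ∧
      q.1 (Sen.eq c (c.swap K)) = false} :=
    (hU'.preimage continuous_subtype_val).inter
      (((hU'.preimage (piS_continuous K)).preimage continuous_subtype_val).inter
        ((isOpen_coord _ _).preimage continuous_subtype_val))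
  obtain ⟨q, ⟨q1, q2, q3⟩, q4, q5, q6⟩ := (dense_of_mem_residual hgood).inter_open_nonempty _ hopen
    ⟨⟨tv e, tv_mem e⟩, m1, m2, m3⟩
  obtain ⟨-, g1, hg1, hg1b⟩ := q5 ((hmem q).1 q1).2
  obtain ⟨-, g2, hg2, hg2b⟩ := q6 ((hmem (piH M S0 K q)).1 q2).2
  obtain ⟨g, hg, hinj⟩ := NHom.exists himp hM q4
  have hg2' : NHom S1 q.1 _ := NHom.swap K hg2
  have u1 := NHom.unique himp hM q4 hg hg1
  have u2 := NHom.unique himp hM q4 hg hg2'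
  have : q.1 (Sen.eq c (c.swap K)) = true := by
    refine hinj s hs _ _ ?_
    have v1 : g ⟨⟨s, hs⟩, c⟩ = b := by rw [u1, hg1b]
    have v2 : g ⟨⟨s, hs⟩, c.swap K⟩ = b := by
      rw [u2]
      show g2 ⟨⟨s, hs⟩, (c.swap K).swap K⟩ = b
      rw [Nm.swap_swap, hg2b]
    rw [v1, v2]
  rw [q3] at this
  exact absurd this (by simp)

end Pin

section Final

variable {M : MStr σ} {S0 : Set σ.Sorts}

theorem pinned_exists [Countable σ.Sorts] [Countable σ.Rels] [∀ s, Countable (M.dom s)]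
    {T : Set (MForm σ [])} {S1 : Set σ.Sorts} {h01 : S0 ⊆ S1}
    (himp : ImplInterp T S0 S1 h01) (hM : M.Models T) :
    ∃ p ∈ XH M S0, ∀ j : NJ M S0 S1, ∃ (x : M.dom j.1.1) (U : Set (Sen M S0 → Bool)),
      IsOpen U ∧ p ∈ U ∧ ∀ e : MVal M S0, tv e ∈ U → e.e _ j.2 = x := by
  have := isCompact_X0 M S0
  have hNm : ∀ s, Countable (Nm M S0 s) := fun s => Nm.countable M S0 s
  have hc : Countable (NJ M S0 S1) := inferInstance
  have h := (countable_iInter_mem.2 fun j : NJ M S0 S1 => pin_dense himp hM j)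
  have h2 := Filter.inter_mem (XH_residual M S0) h
  obtain ⟨e⟩ : Nonempty (MVal M S0) := inferInstance
  have : Nonempty (X0 M S0) := ⟨⟨tv e, tv_mem e⟩⟩
  obtain ⟨p, hp, hp'⟩ := (dense_of_mem_residual h2).nonempty
  exact ⟨p.1, hp, fun j => Set.mem_iInter.1 hp' j⟩

theorem named [Countable σ.Sorts] [Countable σ.Rels] [∀ s, Countable (M.dom s)]
    {T : Set (MForm σ [])} {S1 : Set σ.Sorts} {h01 : S0 ⊆ S1}
    (himp : ImplInterp T S0 S1 h01) (hM : M.Models T) :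
    ∃ p ∈ X0 M S0, ∀ s ∈ S1, ∀ b : M.dom s, ∃ (c : Nm M S0 s) (U : Set (Sen M S0 → Bool)),
      IsOpen U ∧ p ∈ U ∧ ∀ e : MVal M S0, tv e ∈ U → e.e _ c = b := by
  obtain ⟨p, ⟨hp, hH⟩, h⟩ := pinned_exists himp hM
  refine ⟨p, hp, ?_⟩
  choose d U hU hpU hd using h
  obtain ⟨g, g', h1, h2, h3, h4, h5⟩ := twoway himp (NMod hp) M (NMod.models hp hH hM) hM
    (NMod.f hp) (NMod.f_bij hp) (NMod.f_rel hp)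
  choose k hk using fun s (hs : s ∈ S1) (b : M.dom s) => NMod.mk_surj hp (g' s hs b)
  obtain ⟨l, -, hl⟩ := himp M M hM hM (fun s hs x => x) (fun s hs => Function.bijective_id)
    (fun r hr a => Iff.rfl)
  have l1 := hl (fun s hs x => x) ⟨fun s hs => rfl, fun r hr a h => h⟩
  have l2 := hl (fun s hs x => d ⟨⟨s, hs⟩, k s hs x⟩) ⟨?_, ?_⟩
  · intro s hs b
    refine ⟨k s hs b, U ⟨⟨s, hs⟩, k s hs b⟩, hU _, hpU _, fun e he => ?_⟩
    rw [hd ⟨⟨s, hs⟩, k s hs b⟩ e he]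
    exact congrFun (congrFun (congrFun (l2.trans l1.symm) s) hs) b
  · intro s hs
    funext m
    obtain ⟨e0⟩ : Nonempty (MVal M S0) := inferInstance
    have h6 : g' s (h01 hs) m = NMod.mk hp (.par hs m) := by
      have := h3 s hs (NMod.mk hp (.par hs m))
      rw [NMod.f_mk hp s hs _ e0, e0.epar] at this
      exact this
    have h7 := hk s (h01 hs) m
    rw [h6, NMod.mk_eq] at h7
    obtain ⟨e, he, he'⟩ := X0.open_sat hp ((hU ⟨⟨s, h01 hs⟩, k s (h01 hs) m⟩).inter
      (isOpen_coord (Sen.eq (k s (h01 hs) m) (.par hs m)) true)) ⟨hpU _, h7⟩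
    have h8 := (tv_eq _ _ _).1 he'
    rw [e.epar] at h8
    exact (hd ⟨⟨s, h01 hs⟩, k s (h01 hs) m⟩ e he).symm.trans h8
  · intro r hr a ha
    have h6 := h4 r hr a ha
    simp only [← hk] at h6
    rw [NMod.rel_iff] at h6
    obtain ⟨e, he, he'⟩ := X0.open_sat hp
      ((isOpen_iInter_of_finite fun i : Fin (σ.arity r).length =>
          hU ⟨⟨_, hr i⟩, k _ (hr i) (a i)⟩).inter
        (isOpen_coord (Sen.rel r fun i => k _ (hr i) (a i)) true))
      ⟨Set.mem_iInter.2 fun i => hpU _, h6⟩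
    have h8 := (tv_rel _ _ _).1 he'
    have h9 : ∀ i, e.e _ (k _ (hr i) (a i)) = d ⟨⟨_, hr i⟩, k _ (hr i) (a i)⟩ := fun i =>
      hd ⟨⟨_, hr i⟩, k _ (hr i) (a i)⟩ e (Set.mem_iInter.1 he i)
    simp only [h9] at h8
    exact h8

/-- The environment of values of a list of names. -/
def Lenv (e : MVal M S0) : ∀ L : List (Σ s, Nm M S0 s), MEnv M (L.map Sigma.fst)
  | [] => MEnv.nil
  | n :: L => MEnv.cons (e.e n.1 n.2) (Lenv e L)

theorem Lenv_mem (L : List (Σ s, Nm M S0 s)) (n : Σ s, Nm M S0 s) (h : n ∈ L) :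
    ∃ v : MVar (L.map Sigma.fst) n.1, ∀ e, v.val (Lenv e L) = e.e n.1 n.2 := by
  induction L with
  | nil => exact absurd h (by simp)
  | cons m L ih =>
    rcases List.mem_cons.1 h with rfl | h
    · exact ⟨⟨⟨0, Nat.succ_pos _⟩, rfl⟩, fun e => rfl⟩
    · obtain ⟨v, hv⟩ := ih h
      exact ⟨v.wk m.1, hv⟩

theorem Lenv_congr (L : List (Σ s, Nm M S0 s)) (e e' : MVal M S0)
    (h : ∀ n ∈ L, e.e n.1 n.2 = e'.e n.1 n.2) : Lenv e L = Lenv e' L := by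
  induction L with
  | nil => rfl
  | cons m L ih =>
    rw [Lenv, Lenv, h m (by simp), ih fun n hn => h n (by simp [hn])]

/-- Projection of the names. -/
theorem project (L : List (Σ s, Nm M S0 s)) (hL : L.Nodup) :
    ∀ (Δ : List σ.Sorts) (φ : MForm σ (L.map Sigma.fst ++ Δ)),
      ∃ Δa : List σ.Sorts, (∀ s ∈ Δa, s ∈ S0) ∧ ∃ (a : MEnv M Δa) (ψ : MForm σ (Δ ++ Δa)),
        ∀ ρ : MEnv M Δ, ψ.Sat (MEnv.append a ρ) ↔
          ∃ e : MVal M S0, φ.Sat (MEnv.append ρ (Lenv e L)) := by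
  induction L with
  | nil =>
    intro Δ φ
    obtain ⟨ψ, hψ⟩ := rename_exists (M := M) (Γ := Δ) φ (Δ ++ []) (MEnv M Δ) (fun ρ => ρ)
      (fun ρ => MEnv.append (MEnv.nil (M := M)) ρ) (by
        intro s v
        obtain ⟨v', hv'⟩ := append_inl (M := M) (Γ₂ := []) v
        exact ⟨v', fun ρ => (hv' _ _).symm⟩)
    refine ⟨[], by simp, MEnv.nil, ψ, fun ρ => ?_⟩
    rw [← hψ]
    exact ⟨fun h => ⟨Classical.arbitrary _, h⟩, fun ⟨_, h⟩ => h⟩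
  | cons n L ih =>
    intro Δ φ
    obtain ⟨s, c⟩ := n
    rw [List.nodup_cons] at hL
    obtain ⟨φ', hφ'⟩ := rename_exists (M := M) (Γ := s :: (L.map Sigma.fst ++ Δ)) φ
      (L.map Sigma.fst ++ (s :: Δ)) (M.dom s × MEnv M (L.map Sigma.fst) × MEnv M Δ)
      (fun i => MEnv.cons i.1 (MEnv.append i.2.2 i.2.1))
      (fun i => MEnv.append (MEnv.cons i.1 i.2.2) i.2.1) (by
        intro t v
        rcases v.cons_cases with ⟨rfl, rfl⟩ | ⟨w, rfl⟩
        · obtain ⟨v', hv'⟩ := append_inr (M := M) (Γ₁ := L.map Sigma.fst) (Γ₂ := s :: Δ)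
            (⟨⟨0, Nat.succ_pos _⟩, rfl⟩ : MVar (s :: Δ) s)
          exact ⟨v', fun i => (hv' i.2.1 (MEnv.cons i.1 i.2.2)).symm⟩
        · rcases append_cases M w with ⟨u, hu⟩ | ⟨u, hu⟩
          · obtain ⟨v', hv'⟩ := append_inl (M := M) (Γ₁ := L.map Sigma.fst) (Γ₂ := s :: Δ) u
            exact ⟨v', fun i => (hu _ _).trans (hv' _ _).symm⟩
          · obtain ⟨v', hv'⟩ := append_inr (M := M) (Γ₁ := L.map Sigma.fst) (Γ₂ := s :: Δ)
              (u.wk s)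
            exact ⟨v', fun i => (hu _ _).trans (hv' i.2.1 (MEnv.cons i.1 i.2.2)).symm⟩)
    obtain ⟨Δa, hΔa, a, ψ, hψ⟩ := ih hL.2 (s :: Δ) φ'
    have key : ∀ (e : MVal M S0) (ρ : MEnv M Δ),
        φ.Sat (MEnv.append ρ (Lenv e (⟨s, c⟩ :: L))) ↔
          φ'.Sat (MEnv.append (MEnv.cons (e.e s c) ρ) (Lenv e L)) := fun e ρ =>
      hφ' (e.e s c, Lenv e L, ρ)
    cases c with
    | par hs m =>
      obtain ⟨ψ', hψ'⟩ := rename_exists (M := M) (Γ := s :: (Δ ++ Δa)) ψ (Δ ++ (s :: Δa))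
        (MEnv M Δ) (fun ρ => MEnv.cons m (MEnv.append a ρ))
        (fun ρ => MEnv.append (MEnv.cons m a) ρ) (by
          intro t v
          rcases v.cons_cases with ⟨rfl, rfl⟩ | ⟨w, rfl⟩
          · obtain ⟨v', hv'⟩ := append_inr (M := M) (Γ₁ := Δ) (Γ₂ := s :: Δa)
              (⟨⟨0, Nat.succ_pos _⟩, rfl⟩ : MVar (s :: Δa) s)
            exact ⟨v', fun ρ => (hv' ρ (MEnv.cons m a)).symm⟩
          · rcases append_cases M w with ⟨u, hu⟩ | ⟨u, hu⟩
            · obtain ⟨v', hv'⟩ := append_inl (M := M) (Γ₁ := Δ) (Γ₂ := s :: Δa) u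
              exact ⟨v', fun i => (hu _ _).trans (hv' _ _).symm⟩
            · obtain ⟨v', hv'⟩ := append_inr (M := M) (Γ₁ := Δ) (Γ₂ := s :: Δa) (u.wk s)
              exact ⟨v', fun i => (hu _ _).trans (hv' i (MEnv.cons m a)).symm⟩)
      refine ⟨s :: Δa, ?_, MEnv.cons m a, ψ', fun ρ => ?_⟩
      · intro t ht
        rcases List.mem_cons.1 ht with rfl | ht
        · exact hs
        · exact hΔa t ht
      · rw [← hψ' ρ]
        refine (hψ (MEnv.cons m ρ)).trans (exists_congr fun e => ?_)
        rw [key, e.epar]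
    | var hs hne n =>
      refine ⟨Δa, hΔa, a, MForm.ex s ψ, fun ρ => ?_⟩
      rw [sat_ex]
      constructor
      · rintro ⟨x, hx⟩
        obtain ⟨e, he⟩ := (hψ (MEnv.cons x ρ)).1 hx
        refine ⟨e.upd hs hne n x, ?_⟩
        rw [key, MVal.upd_self, Lenv_congr L _ e]
        · exact he
        · intro k hk
          exact MVal.upd_of_ne _ _ _ _ _ _ fun h => hL.1 (h ▸ hk)
      · rintro ⟨e, he⟩
        rw [key] at he
        exact ⟨_, (hψ (MEnv.cons _ ρ)).2 ⟨e, he⟩⟩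

/-- Finite conjunctions. -/
theorem conj_exists {Γ : List σ.Sorts} {ι : Type} (s : Finset ι) (φ : ι → MForm σ Γ) :
    ∃ ψ : MForm σ Γ, ∀ ρ : MEnv M Γ, ψ.Sat ρ ↔ ∀ i ∈ s, (φ i).Sat ρ := by
  classical
  induction s using Finset.induction_on with
  | empty => exact ⟨.imp .fal .fal, fun ρ => by simp [MForm.Sat]⟩
  | insert i s hi ih =>
    obtain ⟨ψ, hψ⟩ := ih
    refine ⟨((φ i).imp (ψ.imp .fal)).imp .fal, fun ρ => ?_⟩
    simp only [MForm.Sat, hψ, Finset.forall_mem_insert]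
    tauto

theorem sen_form (L : List (Σ s, Nm M S0 s)) (Δ : List σ.Sorts) (t : Sen M S0)
    (ht : ∀ i, (⟨t.ctx.get i, t.nu i⟩ : Σ s, Nm M S0 s) ∈ L) (b : Bool) :
    ∃ ψ : MForm σ (L.map Sigma.fst ++ Δ), ∀ (e : MVal M S0) (ρ : MEnv M Δ),
      ψ.Sat (MEnv.append ρ (Lenv e L)) ↔ tv e t = b := by
  obtain ⟨Γ, φ, ν⟩ := t
  obtain ⟨ψ, hψ⟩ := rename_exists (M := M) φ (L.map Sigma.fst ++ Δ) (MVal M S0 × MEnv M Δ)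
    (fun i => i.1.env ν) (fun i => MEnv.append i.2 (Lenv i.1 L)) (by
      rintro s ⟨i, rfl⟩
      obtain ⟨v, hv⟩ := Lenv_mem L _ (ht i)
      obtain ⟨v', hv'⟩ := append_inl (M := M) (Γ₂ := Δ) v
      exact ⟨v', fun k => ((hv' _ _).trans (hv _)).symm⟩)
  have hψ' : ∀ (e : MVal M S0) (ρ : MEnv M Δ),
      ψ.Sat (MEnv.append ρ (Lenv e L)) ↔ tv e ⟨Γ, φ, ν⟩ = true := fun e ρ => by
    rw [tv_iff]
    exact (hψ (e, ρ)).symm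
  cases b with
  | true => exact ⟨ψ, hψ'⟩
  | false =>
    refine ⟨ψ.imp .fal, fun e ρ => ?_⟩
    rw [← Bool.not_eq_true, ← hψ' e ρ]
    rfl

theorem eq_form (L : List (Σ s, Nm M S0 s)) (Δ : List σ.Sorts) (i : Fin Δ.length)
    (c : Nm M S0 (Δ.get i)) (hc : (⟨Δ.get i, c⟩ : Σ s, Nm M S0 s) ∈ L) :
    ∃ ψ : MForm σ (L.map Sigma.fst ++ Δ), ∀ (e : MVal M S0) (ρ : MEnv M Δ),
      ψ.Sat (MEnv.append ρ (Lenv e L)) ↔ e.e _ c = ρ i := by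
  obtain ⟨v, hv⟩ := Lenv_mem L _ hc
  obtain ⟨v', hv'⟩ := append_inl (M := M) (Γ₂ := Δ) v
  obtain ⟨w, hw⟩ := append_inr (M := M) (Γ₁ := L.map Sigma.fst) (MVar.self i)
  refine ⟨.eq v' w, fun e ρ => ?_⟩
  simp only [MForm.Sat, hv', hv, hw]
  rfl

end Final

/-- **Isolation of types over the input sorts** (Lemma 3.16): for a theory `T` in a
countable multi-sorted signature with `S₁` implicitly interpretable over `S₀ ⊆ S₁`
relative to `T`, in every countable model `M` of `T` the type of any tuple `b` over `S₁`
with parameters from `S₀` is isolated over `S₀`: there are a parameter tuple `ā` from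
`S₀`-sorts and a formula `φ₀(x̄, ā)` satisfied by `b` such that every formula with
parameters from `S₀` satisfied by `b` is implied (in `M`) by `φ₀(x̄, ā)`. -/
theorem implicit_interp_types_isolated (σ : MSig)
    [Countable σ.Sorts] [Countable σ.Rels]
    (T : Set (MForm σ [])) (S0 S1 : Set σ.Sorts) (h01 : S0 ⊆ S1)
    (himp : ImplInterp T S0 S1 h01)
    (M : MStr σ) (hM : M.Models T) (hcount : ∀ s : σ.Sorts, Countable (M.dom s))
    (Δb : List σ.Sorts) (hΔb : ∀ s ∈ Δb, s ∈ S1) (b : MEnv M Δb) :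
    ∃ (Δa : List σ.Sorts), (∀ s ∈ Δa, s ∈ S0) ∧
      ∃ (a : MEnv M Δa) (φ₀ : MForm σ (Δb ++ Δa)),
        φ₀.Sat (MEnv.append a b) ∧
        ∀ (Δp : List σ.Sorts), (∀ s ∈ Δp, s ∈ S0) →
          ∀ (params : MEnv M Δp) (γ : MForm σ (Δb ++ Δp)),
            γ.Sat (MEnv.append params b) →
            ∀ b' : MEnv M Δb,
              φ₀.Sat (MEnv.append a b') → γ.Sat (MEnv.append params b') := by

  classical
  obtain ⟨p, hp, hn⟩ := named himp hM
  choose c U hU hpU hc using fun i : Fin Δb.length => hn (Δb.get i) (hΔb _ (List.get_mem _ _)) (b i)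
  obtain ⟨F, hF⟩ := open_fin (isOpen_iInter_of_finite hU) (Set.mem_iInter.2 hpU)
  have hF' : ∀ e : MVal M S0, (∀ t ∈ F, tv e t = p t) → ∀ i, e.e _ (c i) = b i :=
    fun e he i => hc i e (Set.mem_iInter.1 (hF _ he) i)
  obtain ⟨N, hN1, hN2⟩ : ∃ N : Finset (Σ s, Nm M S0 s),
      (∀ t ∈ F, ∀ i, (⟨t.ctx.get i, t.nu i⟩ : Σ s, Nm M S0 s) ∈ N) ∧
      (∀ i, (⟨Δb.get i, c i⟩ : Σ s, Nm M S0 s) ∈ N) := by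
    refine ⟨(F.biUnion fun t => Finset.univ.image fun i => ⟨t.ctx.get i, t.nu i⟩) ∪
      Finset.univ.image fun i => ⟨Δb.get i, c i⟩, ?_, ?_⟩
    · intro t ht i
      exact Finset.mem_union_left _ (Finset.mem_biUnion.2
        ⟨t, ht, Finset.mem_image.2 ⟨i, Finset.mem_univ _, rfl⟩⟩)
    · intro i
      exact Finset.mem_union_right _ (Finset.mem_image.2 ⟨i, Finset.mem_univ _, rfl⟩)
  choose A hA using fun t : F => sen_form N.toList Δb t.1
    (fun i => Finset.mem_toList.2 (hN1 t.1 t.2 i)) (p t.1)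
  choose B hB using fun i => eq_form N.toList Δb i (c i) (Finset.mem_toList.2 (hN2 i))
  obtain ⟨φ1, h1⟩ := conj_exists (M := M) Finset.univ A
  obtain ⟨φ2, h2⟩ := conj_exists (M := M) Finset.univ B
  obtain ⟨Δa, hΔa, a, ψ, hψ⟩ := project N.toList N.nodup_toList Δb
    ((φ1.imp (φ2.imp .fal)).imp .fal)
  have hψ' : ∀ ρ : MEnv M Δb, ψ.Sat (MEnv.append a ρ) ↔
      ∃ e : MVal M S0, (∀ t ∈ F, tv e t = p t) ∧ ∀ i, e.e _ (c i) = ρ i := by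
    intro ρ
    rw [hψ]
    refine exists_congr fun e => ?_
    simp only [MForm.Sat, h1, h2, hA, hB, Finset.mem_univ, forall_true_left, Subtype.forall]
    tauto
  refine ⟨Δa, hΔa, a, ψ, ?_, ?_⟩
  · rw [hψ']
    obtain ⟨e, he⟩ := X0.fin_sat hp F.finite_toSet
    exact ⟨e, he, hF' e he⟩
  · intro Δp _ params γ hγ b' hb'
    obtain ⟨e, he, he'⟩ := (hψ' b').1 hb'
    have : b' = b := by
      funext i
      rw [← he' i, hF' e he i]
    rw [this]
    exact hγ
end

section
/- Under implicit interpretability of sorts S₁ over sorts S₀ relative to a theory Σ in a countable language: in any model M of Σ, every element e of a sort S in S₁ is definable with parameters from S₀, i.e., there is a first-order formula ψ(ȳ, x) with ȳ of sorts in S₀ and a tuple ā in S₀(M) such that e is the unique element of M satisfying ψ(ā, x). -/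
variable {σ : MSig}

namespace Coord

/-- Push an assignment forward along a family of maps. -/
def emap {A B : MStr σ} (f : ∀ s, A.dom s → B.dom s) {Γ : List σ.Sorts} (ρ : MEnv A Γ) :
    MEnv B Γ := fun i => f _ (ρ i)

theorem val_emap {A B : MStr σ} (f : ∀ s, A.dom s → B.dom s) {Γ : List σ.Sorts}
    (ρ : MEnv A Γ) {s : σ.Sorts} (v : MVar Γ s) : v.val (emap f ρ) = f s (v.val ρ) := by
  obtain ⟨i, rfl⟩ := v
  rfl

theorem emap_cons {A B : MStr σ} (f : ∀ s, A.dom s → B.dom s) {Γ : List σ.Sorts}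
    (ρ : MEnv A Γ) {s : σ.Sorts} (x : A.dom s) :
    emap f (MEnv.cons x ρ) = MEnv.cons (f s x) (emap f ρ) := by
  funext i
  refine Fin.cases ?_ (fun j => ?_) i <;> rfl

theorem env_nil {A : MStr σ} (ρ : MEnv A []) : ρ = MEnv.nil := by
  funext i
  exact i.elim0

def vsucc {Γ : List σ.Sorts} {s t : σ.Sorts} (v : MVar Γ s) : MVar (t :: Γ) s :=
  ⟨v.1.succ, v.2⟩

def vzero {Γ : List σ.Sorts} {s : σ.Sorts} : MVar (s :: Γ) s :=
  ⟨⟨0, Nat.succ_pos _⟩, rfl⟩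

theorem val_vzero {A : MStr σ} {Γ : List σ.Sorts} {s : σ.Sorts} (x : A.dom s) (ρ : MEnv A Γ) :
    (vzero : MVar (s :: Γ) s).val (MEnv.cons x ρ) = x := rfl

theorem val_vsucc {A : MStr σ} {Γ : List σ.Sorts} {s t : σ.Sorts} (x : A.dom t) (ρ : MEnv A Γ)
    (v : MVar Γ s) : (vsucc v : MVar (t :: Γ) s).val (MEnv.cons x ρ) = v.val ρ := rfl

/-- Renamings of variables. -/
def Ren (Γ Δ : List σ.Sorts) : Type := ∀ i : Fin Γ.length, MVar Δ (Γ.get i)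

def Ren.app {Γ Δ : List σ.Sorts} (r : Ren Γ Δ) {s : σ.Sorts} (v : MVar Γ s) : MVar Δ s :=
  ⟨(r v.1).1, (r v.1).2.trans v.2⟩

def Ren.lift {Γ Δ : List σ.Sorts} (r : Ren Γ Δ) (s : σ.Sorts) : Ren (s :: Γ) (s :: Δ) :=
  fun i => Fin.cases (motive := fun i => MVar (s :: Δ) ((s :: Γ).get i))
    vzero (fun j => vsucc (r j)) i

def rename : ∀ {Γ : List σ.Sorts}, MForm σ Γ → ∀ {Δ : List σ.Sorts}, Ren Γ Δ → MForm σ Δ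
  | _, .rel R args, _, r => .rel R (fun i => r.app (args i))
  | _, .eq v w, _, r => .eq (r.app v) (r.app w)
  | _, .fal, _, _ => .fal
  | _, .imp φ ψ, _, r => .imp (rename φ r) (rename ψ r)
  | _, .all s φ, _, r => .all s (rename φ (r.lift s))

def Ren.pull {A : MStr σ} {Γ Δ : List σ.Sorts} (r : Ren Γ Δ) (ρ : MEnv A Δ) : MEnv A Γ :=
  fun i => (r i).val ρ

theorem val_app {A : MStr σ} {Γ Δ : List σ.Sorts} (r : Ren Γ Δ) (ρ : MEnv A Δ) {s : σ.Sorts}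
    (v : MVar Γ s) : (r.app v).val ρ = v.val (r.pull ρ) := by
  obtain ⟨i, rfl⟩ := v
  rfl

theorem pull_lift {A : MStr σ} {Γ Δ : List σ.Sorts} (r : Ren Γ Δ) (ρ : MEnv A Δ) {s : σ.Sorts}
    (x : A.dom s) : (r.lift s).pull (MEnv.cons x ρ) = MEnv.cons x (r.pull ρ) := by
  funext i
  refine Fin.cases ?_ (fun j => ?_) i <;> rfl

theorem sat_rename {A : MStr σ} : ∀ {Γ : List σ.Sorts} (φ : MForm σ Γ) {Δ : List σ.Sorts}
    (r : Ren Γ Δ) (ρ : MEnv A Δ), (rename φ r).Sat ρ ↔ φ.Sat (r.pull ρ) := by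
  intro Γ φ
  induction φ with
  | rel R args => intro Δ r ρ; simp [rename, MForm.Sat, val_app]
  | eq v w => intro Δ r ρ; simp [rename, MForm.Sat, val_app]
  | fal => intro Δ r ρ; simp [rename, MForm.Sat]
  | imp φ ψ h1 h2 => intro Δ r ρ; simp [rename, MForm.Sat, h1, h2]
  | all s φ h => intro Δ r ρ; simp [rename, MForm.Sat, h, pull_lift]

/-! ### Countability of formulas -/

def stage (σ : MSig) : ℕ → ∀ Γ : List σ.Sorts, Set (MForm σ Γ)
  | 0, _ => ∅
  | n + 1, Γ =>
    (Set.range fun p : (Σ r : σ.Rels, ∀ i : Fin (σ.arity r).length, MVar Γ ((σ.arity r).get i)) =>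
      MForm.rel p.1 p.2) ∪
    (Set.range fun p : (Σ s : σ.Sorts, MVar Γ s × MVar Γ s) => MForm.eq p.2.1 p.2.2) ∪
    {MForm.fal} ∪
    Set.image2 MForm.imp (stage σ n Γ) (stage σ n Γ) ∪
    ⋃ s, MForm.all s '' stage σ n (s :: Γ)

instance (Γ : List σ.Sorts) (s : σ.Sorts) : Countable (MVar Γ s) := by
  unfold MVar; infer_instance

theorem stage_countable [Countable σ.Sorts] [Countable σ.Rels] (n : ℕ) :
    ∀ Γ : List σ.Sorts, (stage σ n Γ).Countable := by
  induction n with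
  | zero => intro Γ; exact Set.countable_empty
  | succ n ih =>
    intro Γ
    refine ((((Set.countable_range _).union (Set.countable_range _)).union
      (Set.countable_singleton _)).union ((ih Γ).image2 (ih Γ) _)).union ?_
    exact Set.countable_iUnion fun s => (ih _).image _

theorem stage_succ (n : ℕ) : ∀ Γ : List σ.Sorts, stage σ n Γ ⊆ stage σ (n + 1) Γ := by
  induction n with
  | zero => intro Γ; exact Set.empty_subset _
  | succ n ih =>
    intro Γ
    refine Set.union_subset_union (Set.union_subset_union subset_rfl
      (Set.image2_subset (ih Γ) (ih Γ))) ?_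
    exact Set.iUnion_mono fun s => Set.image_mono (ih _)

theorem stage_mono {n m : ℕ} (h : n ≤ m) (Γ : List σ.Sorts) : stage σ n Γ ⊆ stage σ m Γ :=
  monotone_nat_of_le_succ (f := fun n => stage σ n Γ) (fun n => stage_succ n Γ) h

theorem exists_stage {Γ : List σ.Sorts} (φ : MForm σ Γ) : ∃ n, φ ∈ stage σ n Γ := by
  induction φ with
  | rel r args => exact ⟨1, Or.inl (Or.inl (Or.inl (Or.inl ⟨⟨r, args⟩, rfl⟩)))⟩
  | @eq _ s v w => exact ⟨1, Or.inl (Or.inl (Or.inl (Or.inr ⟨⟨s, v, w⟩, rfl⟩)))⟩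
  | fal => exact ⟨1, Or.inl (Or.inl (Or.inr rfl))⟩
  | imp φ ψ h1 h2 =>
    obtain ⟨n, hn⟩ := h1
    obtain ⟨m, hm⟩ := h2
    exact ⟨max n m + 1, Or.inl (Or.inr ⟨φ, stage_mono (le_max_left _ _) _ hn, ψ,
      stage_mono (le_max_right _ _) _ hm, rfl⟩)⟩
  | all s φ h =>
    obtain ⟨n, hn⟩ := h
    exact ⟨n + 1, Or.inr (Set.mem_iUnion.2 ⟨s, φ, hn, rfl⟩)⟩

instance form_countable [Countable σ.Sorts] [Countable σ.Rels] (Γ : List σ.Sorts) :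
    Countable (MForm σ Γ) := by
  rw [← Set.countable_univ_iff]
  refine (Set.countable_iUnion fun n => stage_countable n Γ).mono ?_
  intro φ _
  exact Set.mem_iUnion.2 (exists_stage φ)

/-! ### Downward Löwenheim–Skolem -/

section LS

variable (M : MStr σ)

def SkIdx (A : Set (Σ s, M.dom s)) : Type :=
  Σ Γ : List σ.Sorts, Σ s : σ.Sorts, Σ φ : MForm σ (s :: Γ),
    {ρ : ∀ i : Fin Γ.length, {x : M.dom (Γ.get i) // (⟨_, x⟩ : Σ s, M.dom s) ∈ A} //
      ∃ x : M.dom s, φ.Sat (MEnv.cons x (fun i => (ρ i).1 : MEnv M Γ))}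

noncomputable def skVal (A : Set (Σ s, M.dom s)) (p : SkIdx M A) : Σ s, M.dom s :=
  ⟨p.2.1, p.2.2.2.2.choose⟩

noncomputable def hull (A : Set (Σ s, M.dom s)) : ℕ → Set (Σ s, M.dom s)
  | 0 => A
  | n + 1 => hull A n ∪ Set.range (skVal M (hull A n))

theorem hull_mono (A : Set (Σ s, M.dom s)) : Monotone (hull M A) :=
  monotone_nat_of_le_succ fun _ => Set.subset_union_left

theorem hull_countable [Countable σ.Sorts] [Countable σ.Rels] (A : Set (Σ s, M.dom s))
    (hA : A.Countable) (n : ℕ) : (hull M A n).Countable := by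
  induction n with
  | zero => exact hA
  | succ n ih =>
    refine ih.union ?_
    have : Countable (hull M A n) := ih
    have h2 : ∀ t, Countable {x : M.dom t // (⟨t, x⟩ : Σ s, M.dom s) ∈ hull M A n} := by
      intro t
      refine Function.Injective.countable
        (f := fun x => (⟨⟨t, x.1⟩, x.2⟩ : hull M A n)) ?_
      intro x y hxy
      simpa [Subtype.ext_iff] using hxy
    have : Countable (SkIdx M (hull M A n)) := by unfold SkIdx; infer_instance
    exact Set.countable_range _

def sub (A : Set (Σ s, M.dom s)) : MStr σ where
  dom s := {x : M.dom s // ∃ n, (⟨s, x⟩ : Σ s, M.dom s) ∈ hull M A n}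
  rel r a := M.rel r (fun i => (a i).1)

def incl (A : Set (Σ s, M.dom s)) (s : σ.Sorts) (x : (sub M A).dom s) : M.dom s := x.1

theorem sub_elem (A : Set (Σ s, M.dom s)) : ∀ {Γ : List σ.Sorts} (φ : MForm σ Γ)
    (ρ : MEnv (sub M A) Γ), φ.Sat ρ ↔ φ.Sat (emap (incl M A) ρ) := by
  intro Γ φ
  induction φ with
  | rel r args => intro ρ; simp only [MForm.Sat, val_emap]; rfl
  | eq v w => intro ρ; simp only [MForm.Sat, val_emap]; exact Subtype.ext_iff
  | fal => intro ρ; rfl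
  | imp φ ψ h1 h2 => intro ρ; simp only [MForm.Sat, h1, h2]
  | @all Γ s φ h =>
    intro ρ
    simp only [MForm.Sat, h, emap_cons]
    constructor
    · intro H x
      by_contra hx
      have hex : ∀ i, ∃ n, (⟨_, (ρ i).1⟩ : Σ s, M.dom s) ∈ hull M A n := fun i => (ρ i).2
      choose n hn using hex
      obtain ⟨N, hN⟩ : ∃ N, ∀ i, n i ≤ N :=
        ⟨Finset.univ.sup n, fun i => Finset.le_sup (Finset.mem_univ i)⟩
      let p : SkIdx M (hull M A N) := ⟨Γ, s, φ.not,
        fun i => ⟨(ρ i).1, hull_mono M A (hN i) (hn i)⟩, x, fun h => hx h⟩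
      have hp := p.2.2.2.2.choose_spec
      have hmem : skVal M (hull M A N) p ∈ hull M A (N + 1) := Or.inr ⟨p, rfl⟩
      exact hp (H ⟨p.2.2.2.2.choose, N + 1, hmem⟩)
    · intro H x
      exact H _

theorem exists_countable_elem [Countable σ.Sorts] [Countable σ.Rels] (s : σ.Sorts)
    (e : M.dom s) : ∃ (M₀ : MStr σ) (ι : ∀ s, M₀.dom s → M.dom s),
      (∀ s, Countable (M₀.dom s)) ∧
      (∀ {Γ : List σ.Sorts} (φ : MForm σ Γ) (ρ : MEnv M₀ Γ), φ.Sat ρ ↔ φ.Sat (emap ι ρ)) ∧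
      ∃ e₀, ι s e₀ = e := by
  refine ⟨sub M {⟨s, e⟩}, incl M {⟨s, e⟩}, ?_, sub_elem M _,
    ⟨⟨e, 0, Set.mem_singleton _⟩, rfl⟩⟩
  intro t
  have : (⋃ n, hull M {⟨s, e⟩} n).Countable :=
    Set.countable_iUnion fun n => hull_countable M _ (Set.countable_singleton _) n
  have : Countable (⋃ n, hull M {⟨s, e⟩} n) := this
  refine Function.Injective.countable (β := (⋃ n, hull M {⟨s, e⟩} n))
    (f := fun x => ⟨⟨t, x.1⟩, Set.mem_iUnion.2 x.2⟩) ?_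
  intro x y hxy
  apply Subtype.ext
  simpa [Subtype.ext_iff] using hxy

end LS

/-! ### A Baire category lemma -/

section Topo

open Topology Set

theorem baire_uniformize {Y W A : Type*} [TopologicalSpace Y] [PolishSpace Y] [BaireSpace Y]
    [TopologicalSpace W] [PolishSpace W] [Countable A] [TopologicalSpace A] [DiscreteTopology A]
    (Z : Set (Y × W)) (hZ : IsClosed Z) (f : W → A) (hf : Continuous f) (G : Set Y)
    (hGm : @MeasurableSet Y (borel Y) G) (hG : G ∈ residual Y)
    (hex : ∀ y ∈ G, ∃ w, (y, w) ∈ Z)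
    (huniq : ∀ y ∈ G, ∀ w w', (y, w) ∈ Z → (y, w') ∈ Z → w = w')
    (O : Set Y) (hO : IsOpen O) (hne : O.Nonempty) :
    ∃ (a : A) (V : Set Y), IsOpen V ∧ V.Nonempty ∧ V ⊆ O ∧
      {y | y ∈ V → ∃ w, (y, w) ∈ Z ∧ f w = a} ∈ residual Y := by
  let _ : MeasurableSpace Y := borel Y
  have : BorelSpace Y := ⟨rfl⟩
  let _ : MeasurableSpace W := borel W
  have : BorelSpace W := ⟨rfl⟩
  let B : A → Set Y := fun a => Prod.fst '' (Z ∩ (Prod.fst ⁻¹' G) ∩ (Prod.snd ⁻¹' (f ⁻¹' {a})))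
  have hBm : ∀ a, MeasurableSet (B a) := by
    intro a
    refine MeasurableSet.image_of_continuousOn_injOn ?_ continuous_fst.continuousOn ?_
    · refine (hZ.measurableSet.inter (measurable_fst hGm)).inter ?_
      exact (((isClosed_discrete {a}).preimage hf).preimage continuous_snd).measurableSet
    · rintro ⟨y, w⟩ ⟨⟨h1, h2⟩, -⟩ ⟨y', w'⟩ ⟨⟨h3, h4⟩, -⟩ h
      simp only at h
      subst h
      rw [huniq y h2 w w' h1 h3]
  have hU : ∀ a, ∃ u, IsOpen u ∧ B a =ᵇ u := fun a => (hBm a).residualEq_isOpen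
  choose u huo hu using hU
  have hall : {y | ∀ a, y ∈ B a ↔ y ∈ u a} ∈ residual Y := by
    have : ∀ a, {y | y ∈ B a ↔ y ∈ u a} ∈ residual Y := fun a =>
      Filter.eventuallyEq_set.1 (hu a)
    have := eventually_countable_forall.2 this
    exact this
  have hd : Dense (⋃ a, u a) := by
    apply dense_of_mem_residual
    filter_upwards [hall, hG] with y h1 h2
    obtain ⟨w, hw⟩ := hex y h2
    exact mem_iUnion.2 ⟨f w, (h1 _).1 ⟨(y, w), ⟨⟨hw, h2⟩, rfl⟩, rfl⟩⟩
  obtain ⟨y, hyO, hy⟩ := hd.inter_open_nonempty O hO hne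
  obtain ⟨a, ha⟩ := mem_iUnion.1 hy
  refine ⟨a, O ∩ u a, hO.inter (huo a), ⟨y, hyO, ha⟩, inter_subset_left, ?_⟩
  filter_upwards [hall] with z hz hzV
  obtain ⟨⟨z', w⟩, ⟨⟨h1, -⟩, h3⟩, rfl⟩ := (hz a).2 hzV.2
  exact ⟨w, h1, h3⟩

end Topo

/-! ### Consequences of implicit interpretability -/

structure SHom {S0 S1 : Set σ.Sorts} (h01 : S0 ⊆ S1) (M N : MStr σ)
    (j : ∀ s, s ∈ S0 → M.dom s → N.dom s)
    (g : ∀ s, s ∈ S1 → N.dom s → M.dom s) : Prop where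
  fix : ∀ s (h : s ∈ S0) m, g s (h01 h) (j s h m) = m
  pres : ∀ (r : σ.Rels) (hr : RelOver S1 r)
    (a : (i : Fin (σ.arity r).length) → N.dom ((σ.arity r).get i)),
    N.rel r a → M.rel r (fun i => g _ (hr i) (a i))

theorem shom_of_implInterp {T : Set (MForm σ [])} {S0 S1 : Set σ.Sorts} {h01 : S0 ⊆ S1}
    (himp : ImplInterp T S0 S1 h01) {M N : MStr σ} (hM : M.Models T) (hN : N.Models T)
    (j : ∀ s, s ∈ S0 → M.dom s → N.dom s)
    (hj : ∀ s (hs : s ∈ S0), Function.Bijective (j s hs))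
    (hjr : ∀ (r : σ.Rels) (hr : RelOver S0 r)
        (a : (i : Fin (σ.arity r).length) → M.dom ((σ.arity r).get i)),
        M.rel r a ↔ N.rel r (fun i => j _ (hr i) (a i))) :
    (∃ g, SHom h01 M N j g) ∧ (∀ g g', SHom h01 M N j g → SHom h01 M N j g' → g = g') ∧
      ∀ g, SHom h01 M N j g → ∀ s hs, Function.Bijective (g s hs) := by
  let E : ∀ s, s ∈ S0 → (M.dom s ≃ N.dom s) := fun s hs => Equiv.ofBijective (j s hs) (hj s hs)
  have hE : ∀ s hs m, E s hs m = j s hs m := fun _ _ _ => rfl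
  obtain ⟨f, ⟨hf1, hf2⟩, -⟩ := himp M N hM hN j hj hjr
  have hNM := himp N M hN hM (fun s hs => (E s hs).symm) (fun s hs => (E s hs).symm.bijective)
    (by
      intro r hr a
      rw [hjr r hr]
      have : (fun i => j _ (hr i) ((E _ (hr i)).symm (a i))) = a := by
        funext i
        exact (E _ (hr i)).apply_symm_apply (a i)
      rw [this])
  have key : ∀ g, SHom h01 M N j g ↔ ((∀ s (hs : s ∈ S0), g s (h01 hs) = (E s hs).symm) ∧
        (∀ (r : σ.Rels) (hr : RelOver S1 r)
          (a : (i : Fin (σ.arity r).length) → N.dom ((σ.arity r).get i)),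
          N.rel r a → M.rel r (fun i => g _ (hr i) (a i)))) := by
    intro g
    constructor
    · rintro ⟨h1, h2⟩
      refine ⟨fun s hs => ?_, h2⟩
      funext n
      obtain ⟨m, rfl⟩ := (hj s hs).2 n
      rw [h1]
      exact ((E s hs).symm_apply_apply m).symm
    · rintro ⟨h1, h2⟩
      refine ⟨fun s hs m => ?_, h2⟩
      rw [h1]
      exact (E s hs).symm_apply_apply m
  refine ⟨?_, ?_, ?_⟩
  · obtain ⟨g, hg, -⟩ := hNM
    exact ⟨g, (key g).2 hg⟩
  · intro g g' hg hg'
    exact hNM.unique ((key g).1 hg) ((key g').1 hg')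
  · intro g hg
    have idM := himp M M hM hM (fun _ _ m => m) (fun _ _ => Function.bijective_id)
      (fun _ _ _ => Iff.rfl)
    have idN := himp N N hN hN (fun _ _ m => m) (fun _ _ => Function.bijective_id)
      (fun _ _ _ => Iff.rfl)
    have h1 := idM.unique (y₁ := fun s hs m => g s hs (f s hs m)) (y₂ := fun _ _ m => m)
      ⟨fun s hs => by funext m; simp only [hf1 s hs]; exact hg.fix s hs m,
        fun r hr a ha => hg.pres r hr _ (hf2 r hr a ha)⟩ ⟨fun _ _ => rfl, fun _ _ _ h => h⟩
    have h2 := idN.unique (y₁ := fun s hs m => f s hs (g s hs m)) (y₂ := fun _ _ m => m)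
      ⟨fun s hs => by
        funext n
        obtain ⟨m, rfl⟩ := (hj s hs).2 n
        simp only [hg.fix s hs m, hf1 s hs], fun r hr a ha => hf2 r hr _ (hg.pres r hr a ha)⟩
      ⟨fun _ _ => rfl, fun _ _ _ h => h⟩
    intro s hs
    refine Function.bijective_iff_has_inverse.2 ⟨f s hs, fun n => ?_, fun m => ?_⟩
    · exact congrFun (congrFun (congrFun h2 s) hs) n
    · exact congrFun (congrFun (congrFun h1 s) hs) m

/-! ### Constants, diagrams and term models -/

section Term

variable (M : MStr σ) (S0 : Set σ.Sorts)

/-- Constants of sort `s`: names for the elements of `S0`-sorts, and infinitely many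
generic constants (none if the sort is empty in `M`). -/
def Kc (s : σ.Sorts) : Type := (PLift (s ∈ S0) × M.dom s) ⊕ (M.dom s × ℕ)

def KS : MStr σ := ⟨Kc M S0, fun _ _ => False⟩

/-- Valuations of the generic constants. -/
def Val : Type := ∀ s : σ.Sorts, M.dom s × ℕ → M.dom s

variable {M} in
def ev (u : Val M) (s : σ.Sorts) : (KS M S0).dom s → M.dom s :=
  Sum.elim (fun p => p.2) (u s)

/-- Sentences with constants. -/
abbrev Phi : Type := Σ Γ : List σ.Sorts, MForm σ Γ × MEnv (KS M S0) Γ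

variable {M} in
open Classical in
noncomputable def Th (u : Val M) : Phi M S0 → Bool :=
  fun p => decide (p.2.1.Sat (emap (ev S0 u) p.2.2))

variable {M S0}

theorem Th_eq_true {u : Val M} {p : Phi M S0} :
    Th S0 u p = true ↔ p.2.1.Sat (emap (ev S0 u) p.2.2) := by
  simp [Th]

def cname {s : σ.Sorts} (h : s ∈ S0) (m : M.dom s) : (KS M S0).dom s := Sum.inl ⟨⟨h⟩, m⟩

def cgen (S0 : Set σ.Sorts) {s : σ.Sorts} (p : M.dom s × ℕ) : (KS M S0).dom s := Sum.inr p

theorem ev_cname (u : Val M) {s : σ.Sorts} (h : s ∈ S0) (m : M.dom s) :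
    ev S0 u s (cname h m) = m := rfl

def eqf {s : σ.Sorts} (k k' : (KS M S0).dom s) : Phi M S0 :=
  ⟨[s, s], MForm.eq vzero (vsucc vzero), MEnv.cons k (MEnv.cons k' MEnv.nil)⟩

def relf (r : σ.Rels)
    (k : (i : Fin (σ.arity r).length) → (KS M S0).dom ((σ.arity r).get i)) : Phi M S0 :=
  ⟨σ.arity r, MForm.rel r (fun i => ⟨i, rfl⟩), k⟩

theorem Th_eqf {u : Val M} {s : σ.Sorts} (k k' : (KS M S0).dom s) :
    Th S0 u (eqf k k') = true ↔ ev S0 u s k = ev S0 u s k' := by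
  rw [Th_eq_true]; rfl

theorem Th_relf {u : Val M} (r : σ.Rels)
    (k : (i : Fin (σ.arity r).length) → (KS M S0).dom ((σ.arity r).get i)) :
    Th S0 u (relf r k) = true ↔ M.rel r (fun i => ev S0 u _ (k i)) := by
  rw [Th_eq_true]; rfl

variable (M S0) in
/-- Diagrams that are finitely satisfiable in `M`. -/
abbrev Diag : Type := {x : Phi M S0 → Bool // x ∈ closure (Set.range (Th (M := M) S0))}

theorem continuous_coord (p : Phi M S0) : Continuous fun x : Diag M S0 => x.1 p :=
  (continuous_apply p).comp continuous_subtype_val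

theorem cyl_open (F : Finset (Phi M S0)) (x : Phi M S0 → Bool) :
    IsOpen {y : Diag M S0 | ∀ p ∈ F, y.1 p = x p} := by
  have : {y : Diag M S0 | ∀ p ∈ F, y.1 p = x p} = ⋂ p ∈ F, {y : Diag M S0 | y.1 p = x p} := by
    ext y; simp
  rw [this]
  refine isOpen_biInter_finset fun p _ => ?_
  exact (isOpen_discrete {x p}).preimage (continuous_coord p)

theorem exists_cyl {O : Set (Diag M S0)} (hO : IsOpen O) {x : Diag M S0} (hx : x ∈ O) :
    ∃ F : Finset (Phi M S0), ∀ y : Diag M S0, (∀ p ∈ F, y.1 p = x.1 p) → y ∈ O := by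
  obtain ⟨O', hO', rfl⟩ := isOpen_induced_iff.1 hO
  obtain ⟨F, u, hu, hsub⟩ := isOpen_pi_iff.1 hO' x.1 hx
  refine ⟨F, fun y hy => hsub ?_⟩
  intro p hp
  rw [hy p hp]
  exact (hu p hp).2

noncomputable def thD (S0 : Set σ.Sorts) (u : Val M) : Diag M S0 :=
  ⟨Th S0 u, subset_closure ⟨u, rfl⟩⟩

theorem agree (x : Diag M S0) (F : Finset (Phi M S0)) :
    ∃ u : Val M, ∀ p ∈ F, Th S0 u p = x.1 p := by
  have ho : IsOpen {y : Phi M S0 → Bool | ∀ p ∈ F, y p = x.1 p} := by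
    have : {y : Phi M S0 → Bool | ∀ p ∈ F, y p = x.1 p} =
        ⋂ p ∈ F, {y : Phi M S0 → Bool | y p = x.1 p} := by
      ext y; simp
    rw [this]
    refine isOpen_biInter_finset fun p _ => ?_
    exact (isOpen_discrete {x.1 p}).preimage
      (f := fun y : Phi M S0 → Bool => y p) (continuous_apply p)
  obtain ⟨y, hy, ⟨u, rfl⟩⟩ := mem_closure_iff.1 x.2 _ ho (fun _ _ => rfl)
  exact ⟨u, hy⟩

open Classical in
/-- agreement on a finite indexed family -/
theorem agree' (x : Diag M S0) {ι : Type} [Finite ι] (f : ι → Phi M S0) (l : List (Phi M S0)) :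
    ∃ u : Val M, (∀ i, Th S0 u (f i) = x.1 (f i)) ∧ ∀ p ∈ l, Th S0 u p = x.1 p := by
  have := Fintype.ofFinite ι
  obtain ⟨u, hu⟩ := agree x (Finset.univ.image f ∪ l.toFinset)
  exact ⟨u, fun i => hu _ (by simp), fun p hp => hu _ (by simp [hp])⟩

theorem agreeL (x : Diag M S0) (l : List (Phi M S0)) :
    ∃ u : Val M, ∀ p ∈ l, Th S0 u p = x.1 p := by
  obtain ⟨u, -, hu⟩ := agree' x (fun e : Empty => e.elim) l
  exact ⟨u, hu⟩

theorem eqf_refl (x : Diag M S0) {s : σ.Sorts} (k : (KS M S0).dom s) :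
    x.1 (eqf k k) = true := by
  obtain ⟨u, hu⟩ := agreeL x [eqf k k]
  rw [← hu _ (by simp), Th_eqf]

theorem eqf_symm (x : Diag M S0) {s : σ.Sorts} {k k' : (KS M S0).dom s}
    (h : x.1 (eqf k k') = true) : x.1 (eqf k' k) = true := by
  obtain ⟨u, hu⟩ := agreeL x [eqf k k', eqf k' k]
  rw [← hu _ (by simp), Th_eqf] at h ⊢
  exact h.symm

theorem eqf_trans (x : Diag M S0) {s : σ.Sorts} {k k' k'' : (KS M S0).dom s}
    (h : x.1 (eqf k k') = true) (h' : x.1 (eqf k' k'') = true) : x.1 (eqf k k'') = true := by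
  obtain ⟨u, hu⟩ := agreeL x [eqf k k', eqf k' k'', eqf k k'']
  rw [← hu _ (by simp), Th_eqf] at h h' ⊢
  exact h.trans h'

def ksetoid (x : Diag M S0) (s : σ.Sorts) : Setoid ((KS M S0).dom s) where
  r k k' := x.1 (eqf k k') = true
  iseqv := ⟨eqf_refl x, eqf_symm x, eqf_trans x⟩

/-- The term model of a diagram. -/
def NM (x : Diag M S0) : MStr σ where
  dom s := Quotient (ksetoid x s)
  rel r a := ∃ k : (i : Fin (σ.arity r).length) → (KS M S0).dom ((σ.arity r).get i),
    (∀ i, Quotient.mk (ksetoid x _) (k i) = a i) ∧ x.1 (relf r k) = true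

def cl (x : Diag M S0) (s : σ.Sorts) (k : (KS M S0).dom s) : (NM x).dom s :=
  Quotient.mk (ksetoid x s) k

theorem cl_eq (x : Diag M S0) {s : σ.Sorts} {k k' : (KS M S0).dom s} :
    cl x s k = cl x s k' ↔ x.1 (eqf k k') = true := by
  unfold cl
  exact Quotient.eq (r := ksetoid x s)

theorem cl_surj (x : Diag M S0) {s : σ.Sorts} (n : (NM x).dom s) : ∃ k, cl x s k = n :=
  Quotient.exists_rep n

theorem relf_congr (x : Diag M S0) (r : σ.Rels)
    (k k' : (i : Fin (σ.arity r).length) → (KS M S0).dom ((σ.arity r).get i))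
    (hk : ∀ i, x.1 (eqf (k i) (k' i)) = true) (h : x.1 (relf r k) = true) :
    x.1 (relf r k') = true := by
  obtain ⟨u, hu1, hu2⟩ := agree' x (fun i => eqf (k i) (k' i)) [relf r k, relf r k']
  rw [← hu2 _ (by simp), Th_relf] at h ⊢
  have : (fun i => ev S0 u _ (k i)) = (fun i => ev S0 u _ (k' i)) := by
    funext i
    rw [← Th_eqf, hu1, hk]
  rwa [← this]

theorem rel_cl (x : Diag M S0) (r : σ.Rels)
    (k : (i : Fin (σ.arity r).length) → (KS M S0).dom ((σ.arity r).get i)) :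
    (NM x).rel r (fun i => cl x _ (k i)) ↔ x.1 (relf r k) = true := by
  constructor
  · rintro ⟨k', h1, h2⟩
    exact relf_congr x r k' k (fun i => (cl_eq x).1 (h1 i)) h2
  · intro h
    exact ⟨k, fun _ => rfl, h⟩

/-- Generic diagrams: Henkin, and no new elements in the sorts of `S0`. -/
structure Gen (x : Diag M S0) : Prop where
  henkin : ∀ (Γ : List σ.Sorts) (s : σ.Sorts) (φ : MForm σ (s :: Γ)) (κ : MEnv (KS M S0) Γ),
    x.1 ⟨Γ, .all s φ, κ⟩ = true ∨ ∃ k, x.1 ⟨s :: Γ, φ, MEnv.cons k κ⟩ = false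
  std : ∀ (s : σ.Sorts) (h : s ∈ S0) (k : (KS M S0).dom s), ∃ m, x.1 (eqf (cname h m) k) = true

theorem truth {x : Diag M S0} (hx : Gen x) : ∀ {Γ : List σ.Sorts} (φ : MForm σ Γ)
    (κ : MEnv (KS M S0) Γ), φ.Sat (emap (cl x) κ) ↔ x.1 ⟨Γ, φ, κ⟩ = true := by
  intro Γ φ
  induction φ with
  | @rel Γ r args =>
    intro κ
    simp only [MForm.Sat, val_emap]
    rw [rel_cl]
    obtain ⟨u, hu⟩ := agreeL x [relf r (fun i => (args i).val κ), ⟨Γ, .rel r args, κ⟩]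
    rw [← hu _ (by simp), ← hu ⟨Γ, .rel r args, κ⟩ (by simp), Th_relf, Th_eq_true]
    simp only [MForm.Sat, val_emap]
  | @eq Γ s v w =>
    intro κ
    simp only [MForm.Sat, val_emap]
    rw [cl_eq]
    obtain ⟨u, hu⟩ := agreeL x [eqf (v.val κ) (w.val κ), ⟨Γ, .eq v w, κ⟩]
    rw [← hu _ (by simp), ← hu ⟨Γ, .eq v w, κ⟩ (by simp), Th_eqf, Th_eq_true]
    simp only [MForm.Sat, val_emap]
  | @fal Γ =>
    intro κ
    obtain ⟨u, hu⟩ := agreeL x [⟨Γ, .fal, κ⟩]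
    rw [← hu ⟨Γ, .fal, κ⟩ (by simp), Th_eq_true]
    simp only [MForm.Sat]
  | @imp Γ φ ψ h1 h2 =>
    intro κ
    simp only [MForm.Sat, h1, h2]
    obtain ⟨u, hu⟩ := agreeL x [⟨Γ, φ, κ⟩, ⟨Γ, ψ, κ⟩, ⟨Γ, .imp φ ψ, κ⟩]
    rw [← hu ⟨Γ, φ, κ⟩ (by simp), ← hu ⟨Γ, ψ, κ⟩ (by simp), ← hu ⟨Γ, .imp φ ψ, κ⟩ (by simp),
      Th_eq_true, Th_eq_true, Th_eq_true]
    simp only [MForm.Sat]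
  | @all Γ s φ h =>
    intro κ
    simp only [MForm.Sat]
    constructor
    · intro H
      rcases hx.henkin Γ s φ κ with h1 | ⟨k, hk⟩
      · exact h1
      · have := H (cl x s k)
        rw [← emap_cons, h, hk] at this
        exact absurd this (by simp)
    · intro H n
      obtain ⟨k, rfl⟩ := cl_surj x n
      rw [← emap_cons, h]
      obtain ⟨u, hu⟩ := agreeL x [⟨Γ, .all s φ, κ⟩, ⟨s :: Γ, φ, MEnv.cons k κ⟩]
      rw [← hu _ (by simp), Th_eq_true] at H
      rw [← hu _ (by simp), Th_eq_true]
      simp only [MForm.Sat] at H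
      rw [emap_cons]
      exact H _

theorem models_NM {T : Set (MForm σ [])} (hM : M.Models T) {x : Diag M S0} (hx : Gen x) :
    (NM x).Models T := by
  intro φ hφ
  rw [← env_nil (emap (cl x) MEnv.nil), truth hx]
  obtain ⟨u, hu⟩ := agreeL x [⟨[], φ, MEnv.nil⟩]
  rw [← hu _ (by simp), Th_eq_true, env_nil (emap _ _)]
  exact hM φ hφ

/-- Homomorphisms from the `S1`-part of a term model to `M`, at the level of constants. -/
structure KHom {S1 : Set σ.Sorts} (h01 : S0 ⊆ S1) (x : Diag M S0)
    (g : ∀ s : S1, (KS M S0).dom s.1 → M.dom s.1) : Prop where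
  resp : ∀ (s : S1) (k k' : (KS M S0).dom s.1), x.1 (eqf k k') = true → g s k = g s k'
  fix : ∀ (s : σ.Sorts) (h : s ∈ S0) (m : M.dom s), g ⟨s, h01 h⟩ (cname h m) = m
  pres : ∀ (r : σ.Rels) (hr : RelOver S1 r)
    (k : (i : Fin (σ.arity r).length) → (KS M S0).dom ((σ.arity r).get i)),
    x.1 (relf r k) = true → M.rel r (fun i => g ⟨_, hr i⟩ (k i))

theorem khom_of_implInterp {T : Set (MForm σ [])} {S1 : Set σ.Sorts} {h01 : S0 ⊆ S1}
    (himp : ImplInterp T S0 S1 h01) (hM : M.Models T) {x : Diag M S0} (hx : Gen x) :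
    (∃ g, KHom h01 x g) ∧ (∀ g g', KHom h01 x g → KHom h01 x g' → g = g') ∧
      ∀ g, KHom h01 x g → ∀ s, Function.Surjective (g s) ∧
        ∀ k k', g s k = g s k' → x.1 (eqf k k') = true := by
  obtain ⟨H1, H2, H3⟩ := shom_of_implInterp himp hM (models_NM hM hx)
    (fun s h m => cl x s (cname h m))
    (by
      intro s h
      constructor
      · intro m m' hm
        have hm := (cl_eq x).1 hm
        obtain ⟨u, hu⟩ := agreeL x [eqf (cname h m) (cname h m')]
        rw [← hu _ (by simp), Th_eqf] at hm
        exact hm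
      · intro n
        obtain ⟨k, rfl⟩ := cl_surj x n
        obtain ⟨m, hm⟩ := hx.std s h k
        exact ⟨m, (cl_eq x).2 hm⟩)
    (by
      intro r hr a
      rw [rel_cl]
      obtain ⟨u, hu⟩ := agreeL x [relf r (fun i => cname (hr i) (a i))]
      rw [← hu _ (by simp), Th_relf]
      rfl)
  have toS : ∀ g, KHom h01 x g → ∃ g', SHom h01 M (NM x) (fun s h m => cl x s (cname h m)) g' ∧
      ∀ s (hs : s ∈ S1) k, g' s hs (cl x s k) = g ⟨s, hs⟩ k := by
    intro g hg
    refine ⟨fun s hs => Quotient.lift (s := ksetoid x s) (g ⟨s, hs⟩) (hg.resp ⟨s, hs⟩),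
      ⟨fun s h m => hg.fix s h m, ?_⟩, fun _ _ _ => rfl⟩
    intro r hr a ha
    have : ∀ i, ∃ k, cl x _ k = a i := fun i => cl_surj x (a i)
    choose k hk using this
    obtain rfl : (fun i => cl x _ (k i)) = a := funext hk
    exact hg.pres r hr k ((rel_cl x r k).1 ha)
  refine ⟨?_, ?_, ?_⟩
  · obtain ⟨g, hg⟩ := H1
    refine ⟨fun s k => g s.1 s.2 (cl x s.1 k), ⟨?_, fun s h m => hg.fix s h m, ?_⟩⟩
    · intro s k k' h
      rw [(cl_eq x).2 h]
    · intro r hr k h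
      exact hg.pres r hr (fun i => cl x _ (k i)) ((rel_cl x r k).2 h)
  · intro g g' hg hg'
    obtain ⟨f, hf, hf'⟩ := toS g hg
    obtain ⟨f2, hf2, hf2'⟩ := toS g' hg'
    have := H2 f f2 hf hf2
    subst this
    funext s k
    rw [← hf' s.1 s.2, hf2' s.1 s.2]
  · intro g hg s
    obtain ⟨f, hf, hf'⟩ := toS g hg
    have hb := H3 f hf s.1 s.2
    constructor
    · intro m
      obtain ⟨n, rfl⟩ := hb.2 m
      obtain ⟨k, rfl⟩ := cl_surj x n
      exact ⟨k, (hf' s.1 s.2 k).symm⟩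
    · intro k k' hkk
      rw [← cl_eq]
      apply hb.1
      rw [hf' s.1 s.2, hf' s.1 s.2]
      exact hkk

end Term

/-! ### Genericity and category -/

section Cat

variable {M : MStr σ} {S0 : Set σ.Sorts}

instance [∀ s, Countable (M.dom s)] (s : σ.Sorts) : Countable ((KS M S0).dom s) := by
  change Countable ((PLift (s ∈ S0) × M.dom s) ⊕ (M.dom s × ℕ))
  infer_instance

instance [∀ s, Countable (M.dom s)] (Γ : List σ.Sorts) : Countable (MEnv (KS M S0) Γ) := by
  unfold MEnv
  infer_instance

/-- The index of a constant. -/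
def kbd {s : σ.Sorts} : (KS M S0).dom s → ℕ := Sum.elim (fun _ => 0) (fun p => p.2 + 1)

theorem exists_bd (F : Finset (Phi M S0)) (N : ℕ) : ∃ J : ℕ, N ≤ J ∧ ∀ p ∈ F, ∀ i, kbd (p.2.2 i) ≤ J := by
  refine ⟨max N (F.sup fun p => Finset.univ.sup fun i => kbd (p.2.2 i)), le_max_left _ _, ?_⟩
  intro p hp i
  refine le_trans ?_ (le_max_right _ _)
  refine le_trans ?_ (Finset.le_sup (f := fun p : Phi M S0 =>
    Finset.univ.sup fun i => kbd (p.2.2 i)) hp)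
  exact Finset.le_sup (f := fun i => kbd (p.2.2 i)) (Finset.mem_univ i)

theorem Th_congr {u u' : Val M} {p : Phi M S0}
    (h : ∀ i, ev S0 u _ (p.2.2 i) = ev S0 u' _ (p.2.2 i)) : Th S0 u p = Th S0 u' p := by
  have : emap (ev S0 u) p.2.2 = emap (ev S0 u') p.2.2 := funext h
  unfold Th
  rw [this]

open Classical in
/-- Change a valuation at index `J` in sort `s`. -/
noncomputable def upd (u : Val M) (s : σ.Sorts) (J : ℕ) (a : M.dom s) : Val M := fun t p =>
  if p.2 = J then (if h : s = t then h ▸ a else u t p) else u t p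

theorem upd_same (u : Val M) (s : σ.Sorts) (J : ℕ) (a m : M.dom s) :
    upd u s J a s (m, J) = a := by simp [upd]

theorem ev_upd (u : Val M) (s : σ.Sorts) (J : ℕ) (a : M.dom s) {t : σ.Sorts}
    (k : (KS M S0).dom t) (hk : kbd k ≤ J) : ev S0 (upd u s J a) t k = ev S0 u t k := by
  rcases k with k | ⟨m, j⟩
  · rfl
  · have : j + 1 ≤ J := hk
    have hj : j ≠ J := by omega
    change upd u s J a t (m, j) = u t (m, j)
    simp [upd, hj]

theorem exists_thD {O : Set (Diag M S0)} (hO : IsOpen O) (hne : O.Nonempty) :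
    ∃ u : Val M, thD S0 u ∈ O := by
  obtain ⟨x, hx⟩ := hne
  obtain ⟨F, hF⟩ := exists_cyl hO hx
  obtain ⟨u, hu⟩ := agree x F
  exact ⟨u, hF _ hu⟩

theorem henkin_open (Γ : List σ.Sorts) (s : σ.Sorts) (φ : MForm σ (s :: Γ))
    (κ : MEnv (KS M S0) Γ) : IsOpen {x : Diag M S0 | x.1 ⟨Γ, .all s φ, κ⟩ = true ∨
      ∃ k, x.1 ⟨s :: Γ, φ, MEnv.cons k κ⟩ = false} := by
  have : {x : Diag M S0 | x.1 ⟨Γ, .all s φ, κ⟩ = true ∨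
      ∃ k, x.1 ⟨s :: Γ, φ, MEnv.cons k κ⟩ = false} =
      {x : Diag M S0 | x.1 ⟨Γ, .all s φ, κ⟩ = true} ∪
      ⋃ k, {x : Diag M S0 | x.1 ⟨s :: Γ, φ, MEnv.cons k κ⟩ = false} := by
    ext x; simp
  rw [this]
  refine IsOpen.union ((isOpen_discrete {true}).preimage (continuous_coord _))
    (isOpen_iUnion fun k => (isOpen_discrete {false}).preimage (continuous_coord _))

theorem henkin_dense (Γ : List σ.Sorts) (s : σ.Sorts) (φ : MForm σ (s :: Γ))
    (κ : MEnv (KS M S0) Γ) : Dense {x : Diag M S0 | x.1 ⟨Γ, .all s φ, κ⟩ = true ∨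
      ∃ k, x.1 ⟨s :: Γ, φ, MEnv.cons k κ⟩ = false} := by
  classical
  rw [dense_iff_inter_open]
  intro O hO hne
  obtain ⟨u, hu⟩ := exists_thD hO hne
  by_cases h : Th S0 u ⟨Γ, .all s φ, κ⟩ = true
  · exact ⟨_, hu, Or.inl h⟩
  · rw [Th_eq_true] at h
    simp only [MForm.Sat, not_forall] at h
    obtain ⟨a, ha⟩ := h
    obtain ⟨F, hF⟩ := exists_cyl hO hu
    obtain ⟨J, -, hJ⟩ := exists_bd (insert ⟨Γ, .all s φ, κ⟩ F) 0
    refine ⟨thD S0 (upd u s J a), hF _ ?_, Or.inr ⟨cgen S0 (a, J), ?_⟩⟩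
    · intro p hp
      exact Th_congr fun i => ev_upd _ _ _ _ _ (hJ p (by simp [hp]) i)
    · rw [← Bool.not_eq_true]
      change ¬ Th S0 (upd u s J a) _ = true
      rw [Th_eq_true]
      simp only [emap_cons]
      have h1 : ev S0 (upd u s J a) s (cgen S0 (a, J)) = a := upd_same _ _ _ _ _
      have h2 : emap (ev S0 (upd u s J a)) κ = emap (ev S0 u) κ :=
        funext fun i => ev_upd _ _ _ _ _ (hJ ⟨Γ, .all s φ, κ⟩ (by simp) i)
      rw [h1, h2]
      exact ha

theorem std_open (s : σ.Sorts) (h : s ∈ S0) (k : (KS M S0).dom s) :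
    IsOpen {x : Diag M S0 | ∃ m, x.1 (eqf (cname h m) k) = true} := by
  have : {x : Diag M S0 | ∃ m, x.1 (eqf (cname h m) k) = true} =
      ⋃ m, {x : Diag M S0 | x.1 (eqf (cname h m) k) = true} := by
    ext x; simp
  rw [this]
  exact isOpen_iUnion fun m => (isOpen_discrete {true}).preimage (continuous_coord _)

theorem std_dense (s : σ.Sorts) (h : s ∈ S0) (k : (KS M S0).dom s) :
    Dense {x : Diag M S0 | ∃ m, x.1 (eqf (cname h m) k) = true} := by
  rw [dense_iff_inter_open]
  intro O hO hne
  obtain ⟨u, hu⟩ := exists_thD hO hne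
  refine ⟨_, hu, ev S0 u s k, ?_⟩
  change Th S0 u _ = true
  rw [Th_eqf]
  rfl

theorem gen_eq : {x : Diag M S0 | Gen x} =
    (⋂ p : (Σ Γ : List σ.Sorts, Σ s : σ.Sorts, MForm σ (s :: Γ) × MEnv (KS M S0) Γ),
      {x : Diag M S0 | x.1 ⟨p.1, .all p.2.1 p.2.2.1, p.2.2.2⟩ = true ∨
        ∃ k, x.1 ⟨p.2.1 :: p.1, p.2.2.1, MEnv.cons k p.2.2.2⟩ = false}) ∩
    ⋂ p : (Σ s : S0, (KS M S0).dom s.1),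
      {x : Diag M S0 | ∃ m, x.1 (eqf (cname p.1.2 m) p.2) = true} := by
  ext x
  constructor
  · intro h
    refine ⟨Set.mem_iInter.2 fun p => h.henkin _ _ _ _, Set.mem_iInter.2 fun p => h.std _ _ _⟩
  · rintro ⟨h1, h2⟩
    refine ⟨fun Γ s φ κ => Set.mem_iInter.1 h1 ⟨Γ, s, φ, κ⟩,
      fun s h k => Set.mem_iInter.1 h2 ⟨⟨s, h⟩, k⟩⟩

theorem compactD : CompactSpace (Diag M S0) :=
  isCompact_iff_compactSpace.1 (isClosed_closure.isCompact)

theorem polish_pi {ι : Type} [Countable ι] {α : ι → Type} [∀ i, TopologicalSpace (α i)]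
    [∀ i, PolishSpace (α i)] : PolishSpace (∀ i, α i) := inferInstance

variable [Countable σ.Sorts] [Countable σ.Rels] [∀ s, Countable (M.dom s)]

theorem gen_residual : {x : Diag M S0 | Gen x} ∈ residual (Diag M S0) := by
  rw [gen_eq]
  refine Filter.inter_mem (countable_iInter_mem.2 fun p => ?_) (countable_iInter_mem.2 fun p => ?_)
  · exact residual_of_dense_open (henkin_open _ _ _ _) (henkin_dense _ _ _ _)
  · exact residual_of_dense_open (std_open _ _ _) (std_dense _ _ _)

theorem gen_meas : @MeasurableSet (Diag M S0) (borel _) {x : Diag M S0 | Gen x} := by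
  let _ : MeasurableSpace (Diag M S0) := borel _
  have : BorelSpace (Diag M S0) := ⟨rfl⟩
  rw [gen_eq]
  refine MeasurableSet.inter (MeasurableSet.iInter fun p => ?_) (MeasurableSet.iInter fun p => ?_)
  · exact (henkin_open _ _ _ _).measurableSet
  · exact (std_open _ _ _).measurableSet

instance : PolishSpace (Diag M S0) :=
  have : PolishSpace (Phi M S0 → Bool) :=
    have h : PolishSpace Bool := inferInstance
    @polish_pi _ _ _ _ (fun _ => h)
  (isClosed_closure : IsClosed (closure (Set.range (Th (M := M) S0)))).polishSpace

instance : BaireSpace (Diag M S0) := by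
  have := compactD (M := M) (S0 := S0)
  infer_instance

end Cat

section Invol

variable {M : MStr σ} {S0 : Set σ.Sorts}

def sw (J j : ℕ) : ℕ := if j < J then j + J else if j < 2 * J then j - J else j

theorem sw_sw (J j : ℕ) : sw J (sw J j) = j := by
  unfold sw
  split_ifs <;> omega

def kpi (J : ℕ) (s : σ.Sorts) : (KS M S0).dom s → (KS M S0).dom s :=
  Sum.map id (fun p => (p.1, sw J p.2))

theorem kpi_kpi (J : ℕ) (s : σ.Sorts) (k : (KS M S0).dom s) : kpi J s (kpi J s k) = k := by
  rcases k with k | ⟨m, j⟩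
  · rfl
  · change Sum.inr (m, sw J (sw J j)) = _
    rw [sw_sw]

theorem kpi_cname (J : ℕ) {s : σ.Sorts} (h : s ∈ S0) (m : M.dom s) :
    kpi J s (cname h m) = cname h m := rfl

def ppi (J : ℕ) (p : Phi M S0) : Phi M S0 := ⟨p.1, p.2.1, emap (kpi J) p.2.2⟩

theorem ppi_ppi (J : ℕ) (p : Phi M S0) : ppi J (ppi J p) = p := by
  obtain ⟨Γ, φ, κ⟩ := p
  have : emap (kpi J) (emap (kpi J) κ) = κ := funext fun i => kpi_kpi J _ _
  unfold ppi
  simp only [this]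

def upi (J : ℕ) (u : Val M) : Val M := fun s p => u s (p.1, sw J p.2)

theorem ev_kpi (J : ℕ) (u : Val M) (s : σ.Sorts) (k : (KS M S0).dom s) :
    ev S0 u s (kpi J s k) = ev S0 (upi J u) s k := by
  rcases k with k | ⟨m, j⟩ <;> rfl

theorem Th_ppi (J : ℕ) (u : Val M) (p : Phi M S0) : Th S0 u (ppi J p) = Th S0 (upi J u) p := by
  have : emap (ev S0 u) (emap (kpi J) p.2.2) = emap (ev S0 (upi J u)) p.2.2 :=
    funext fun i => ev_kpi J u _ _
  unfold Th ppi
  dsimp only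
  rw [this]

theorem ppi_eqf (J : ℕ) {s : σ.Sorts} (k k' : (KS M S0).dom s) :
    ppi J (eqf k k') = eqf (kpi J s k) (kpi J s k') := by
  unfold ppi eqf
  simp only [emap_cons]
  rw [env_nil (emap (kpi J) MEnv.nil)]

theorem ppi_relf (J : ℕ) (r : σ.Rels)
    (k : (i : Fin (σ.arity r).length) → (KS M S0).dom ((σ.arity r).get i)) :
    ppi J (relf r k) = relf r (fun i => kpi J _ (k i)) := rfl

def dpi (J : ℕ) (x : Diag M S0) : Diag M S0 :=
  ⟨fun p => x.1 (ppi J p), by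
    refine map_mem_closure (f := fun (y : Phi M S0 → Bool) p => y (ppi J p)) ?_ x.2 ?_
    · exact continuous_pi fun p => continuous_apply _
    · rintro _ ⟨u, rfl⟩
      exact ⟨upi J u, funext fun p => (Th_ppi J u p).symm⟩⟩

theorem dpi_dpi (J : ℕ) (x : Diag M S0) : dpi J (dpi J x) = x := by
  apply Subtype.ext
  funext p
  change x.1 (ppi J (ppi J p)) = _
  rw [ppi_ppi]

theorem dpi_cont (J : ℕ) : Continuous (dpi J : Diag M S0 → Diag M S0) := by
  refine Continuous.subtype_mk (continuous_pi fun p => ?_) _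
  exact continuous_coord _

theorem dpi_residual (J : ℕ) {A : Set (Diag M S0)} (hA : A ∈ residual (Diag M S0)) :
    {x | dpi J x ∈ A} ∈ residual (Diag M S0) := by
  let h : Diag M S0 ≃ₜ Diag M S0 :=
    { toFun := dpi J, invFun := dpi J, left_inv := dpi_dpi J, right_inv := dpi_dpi J,
      continuous_toFun := dpi_cont J, continuous_invFun := dpi_cont J }
  exact tendsto_residual_of_isOpenMap h.continuous h.isOpenMap hA

theorem khom_dpi {S1 : Set σ.Sorts} {h01 : S0 ⊆ S1} (J : ℕ) {x : Diag M S0}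
    {g : ∀ s : S1, (KS M S0).dom s.1 → M.dom s.1} (hg : KHom h01 (dpi J x) g) :
    KHom h01 x (fun s k => g s (kpi J s.1 k)) := by
  refine ⟨fun s k k' h => hg.resp s _ _ ?_, fun s h m => ?_, fun r hr k h => hg.pres r hr _ ?_⟩
  · change x.1 (ppi J _) = true
    rw [ppi_eqf, kpi_kpi, kpi_kpi]
    exact h
  · rw [kpi_cname]
    exact hg.fix s h m
  · change x.1 (ppi J _) = true
    rw [ppi_relf]
    simp only [kpi_kpi]
    exact h

end Invol

/-! ### Every constant is decided -/

section Decide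

variable {M : MStr σ} {S0 : Set σ.Sorts}

/-- The finite part `F` of the diagram `x` determines the value of the constant `k`. -/
def Dec (F : Finset (Phi M S0)) (x : Diag M S0) {s : σ.Sorts} (k : (KS M S0).dom s) : Prop :=
  ∀ u u' : Val M, (∀ p ∈ F, Th S0 u p = x.1 p) → (∀ p ∈ F, Th S0 u' p = x.1 p) →
    ev S0 u s k = ev S0 u' s k

theorem khom_closed [∀ s, TopologicalSpace (M.dom s)] [∀ s, DiscreteTopology (M.dom s)]
    {S1 : Set σ.Sorts} (h01 : S0 ⊆ S1) :
    IsClosed {q : Diag M S0 × (∀ s : S1, (KS M S0).dom s.1 → M.dom s.1) | KHom h01 q.1 q.2} := by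
  have hco : ∀ p : Phi M S0, Continuous fun q :
      Diag M S0 × (∀ s : S1, (KS M S0).dom s.1 → M.dom s.1) => q.1.1 p :=
    fun p => (continuous_coord p).comp continuous_fst
  have hg : ∀ (s : S1) (k : (KS M S0).dom s.1), Continuous fun q :
      Diag M S0 × (∀ s : S1, (KS M S0).dom s.1 → M.dom s.1) => q.2 s k :=
    fun s k => by
      have h1 : Continuous fun q :
          Diag M S0 × (∀ s : S1, (KS M S0).dom s.1 → M.dom s.1) => q.2 s :=
        (continuous_apply s).comp continuous_snd
      exact (continuous_apply k).comp h1
  have heq : {q : Diag M S0 × (∀ s : S1, (KS M S0).dom s.1 → M.dom s.1) | KHom h01 q.1 q.2} =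
      (⋂ (s : S1), ⋂ (k : (KS M S0).dom s.1), ⋂ (k' : (KS M S0).dom s.1),
        {q | q.1.1 (eqf k k') = true → q.2 s k = q.2 s k'}) ∩
      (⋂ (s : σ.Sorts), ⋂ (h : s ∈ S0), ⋂ (m : M.dom s),
        {q | q.2 ⟨s, h01 h⟩ (cname h m) = m}) ∩
      (⋂ (r : σ.Rels), ⋂ (hr : RelOver S1 r),
        ⋂ (k : (i : Fin (σ.arity r).length) → (KS M S0).dom ((σ.arity r).get i)),
        {q | q.1.1 (relf r k) = true → M.rel r (fun i => q.2 ⟨_, hr i⟩ (k i))}) := by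
    ext q
    simp only [Set.mem_inter_iff, Set.mem_iInter, Set.mem_setOf_eq]
    exact ⟨fun h => ⟨⟨h.resp, h.fix⟩, h.pres⟩, fun h => ⟨h.1.1, h.1.2, h.2⟩⟩
  rw [heq]
  refine IsClosed.inter (IsClosed.inter ?_ ?_) ?_
  · refine isClosed_iInter fun s => isClosed_iInter fun k => isClosed_iInter fun k' => ?_
    have : Continuous fun q : Diag M S0 × (∀ s : S1, (KS M S0).dom s.1 → M.dom s.1) =>
        (q.1.1 (eqf k k'), q.2 s k, q.2 s k') := (hco _).prodMk ((hg _ _).prodMk (hg _ _))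
    exact (isClosed_discrete {z : Bool × M.dom s.1 × M.dom s.1 | z.1 = true → z.2.1 = z.2.2}).preimage this
  · refine isClosed_iInter fun s => isClosed_iInter fun h => isClosed_iInter fun m => ?_
    exact (isClosed_discrete {m}).preimage (hg ⟨s, h01 h⟩ (cname h m))
  · refine isClosed_iInter fun r => isClosed_iInter fun hr => isClosed_iInter fun k => ?_
    have : Continuous fun q : Diag M S0 × (∀ s : S1, (KS M S0).dom s.1 → M.dom s.1) =>
        (q.1.1 (relf r k), (fun i => q.2 ⟨_, hr i⟩ (k i) :
          ∀ i : Fin (σ.arity r).length, M.dom ((σ.arity r).get i))) :=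
      (hco _).prodMk (continuous_pi fun i => hg _ _)
    exact (isClosed_discrete {z : Bool × (∀ i : Fin (σ.arity r).length, M.dom ((σ.arity r).get i)) |
      z.1 = true → M.rel r z.2}).preimage this

variable [Countable σ.Sorts] [Countable σ.Rels] [∀ s, Countable (M.dom s)]

theorem dec_residual {T : Set (MForm σ [])} {S1 : Set σ.Sorts} {h01 : S0 ⊆ S1}
    (himp : ImplInterp T S0 S1 h01) (hM : M.Models T) (s : S1) (k : (KS M S0).dom s.1) :
    {x : Diag M S0 | ∃ F, Dec F x k} ∈ residual (Diag M S0) := by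
  classical
  refine residual_of_dense_open ?_ ?_
  · rw [isOpen_iff_forall_mem_open]
    rintro x ⟨F, hF⟩
    refine ⟨{y | ∀ p ∈ F, y.1 p = x.1 p}, ?_, cyl_open F x.1, fun _ _ => rfl⟩
    intro y hy
    exact ⟨F, fun u u' hu hu' => hF u u' (fun p hp => (hu p hp).trans (hy p hp))
      (fun p hp => (hu' p hp).trans (hy p hp))⟩
  rw [dense_iff_inter_open]
  intro O hO hne
  let _ : ∀ s, TopologicalSpace (M.dom s) := fun s => ⊥
  have : ∀ s, DiscreteTopology (M.dom s) := fun s => ⟨rfl⟩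
  have hP : ∀ s, PolishSpace (M.dom s) := fun s => inferInstance
  have hW : PolishSpace (∀ s : S1, (KS M S0).dom s.1 → M.dom s.1) :=
    @polish_pi _ _ _ _ (fun s => @polish_pi _ _ _ _ (fun _ => hP s.1))
  obtain ⟨a, V, hVo, ⟨x, hxV⟩, hVO, hV⟩ := baire_uniformize
    {q : Diag M S0 × (∀ s : S1, (KS M S0).dom s.1 → M.dom s.1) | KHom h01 q.1 q.2}
    (khom_closed h01) (fun g => g s k) ((continuous_apply k).comp (continuous_apply s)) {x | Gen x} gen_meas
    gen_residual (fun y hy => (khom_of_implInterp himp hM hy).1)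
    (fun y hy => (khom_of_implInterp himp hM hy).2.1) O hO hne
  obtain ⟨F, hF⟩ := exists_cyl hVo hxV
  refine ⟨x, hVO hxV, F, ?_⟩
  intro u u' hu hu'
  by_contra hne'
  obtain ⟨J, hkJ, hJ⟩ := exists_bd F (kbd k)
  let w : Val M := fun s p => if p.2 < J then u s p else u' s (p.1, p.2 - J)
  have hw1 : ∀ (t : σ.Sorts) (c : (KS M S0).dom t), kbd c ≤ J → ev S0 w t c = ev S0 u t c := by
    intro t c hc
    rcases c with c | ⟨m, j⟩
    · rfl
    · have hj : j + 1 ≤ J := hc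
      change (if j < J then u t (m, j) else u' t (m, j - J)) = u t (m, j)
      rw [if_pos (by omega)]
  have hw2 : ∀ (t : σ.Sorts) (c : (KS M S0).dom t), kbd c ≤ J →
      ev S0 (upi J w) t c = ev S0 u' t c := by
    intro t c hc
    rcases c with c | ⟨m, j⟩
    · rfl
    · have hj : j + 1 ≤ J := hc
      change (if sw J j < J then u t (m, sw J j) else u' t (m, sw J j - J)) = u' t (m, j)
      have : sw J j = j + J := by unfold sw; rw [if_pos (by omega)]
      rw [this, if_neg (by omega), Nat.add_sub_cancel]
  let Q : Set (Diag M S0) := {y | ∀ p ∈ F, y.1 p = x.1 p} ∩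
    dpi J ⁻¹' {y | ∀ p ∈ F, y.1 p = x.1 p} ∩ {y | y.1 (eqf k (kpi J _ k)) = false}
  have hQo : IsOpen Q := ((cyl_open F x.1).inter ((cyl_open F x.1).preimage (dpi_cont J))).inter
    ((isOpen_discrete {false}).preimage (continuous_coord _))
  have hQne : Q.Nonempty := by
    refine ⟨thD S0 w, ⟨?_, ?_⟩, ?_⟩
    · intro p hp
      rw [← hu p hp]
      exact Th_congr fun i => hw1 _ _ (hJ p hp i)
    · intro p hp
      change Th S0 w (ppi J p) = x.1 p
      rw [Th_ppi, ← hu' p hp]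
      exact Th_congr fun i => hw2 _ _ (hJ p hp i)
    · change Th S0 w _ = false
      rw [← Bool.not_eq_true, Th_eqf, ev_kpi, hw1 _ _ hkJ, hw2 _ _ hkJ]
      exact hne'
  have hres := Filter.inter_mem (Filter.inter_mem gen_residual hV) (dpi_residual J hV)
  obtain ⟨y, hyQ, ⟨⟨hyG, hy1⟩, hy2⟩⟩ :=
    (dense_of_mem_residual hres).inter_open_nonempty Q hQo hQne
  obtain ⟨g, hg, hgk⟩ := hy1 (hF y hyQ.1.1)
  obtain ⟨g', hg', hgk'⟩ := hy2 (hF _ hyQ.1.2)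
  obtain ⟨-, H2, H3⟩ := khom_of_implInterp himp hM hyG
  have hgg : g = fun s k => g' s (kpi J s.1 k) := H2 _ _ hg (khom_dpi J hg')
  have h1 : g s (kpi J _ k) = a := by
    rw [hgg]
    change g' s (kpi J _ (kpi J _ k)) = a
    rw [kpi_kpi]
    exact hgk'
  have h2 := (H3 g hg s).2 k (kpi J _ k) (by rw [h1]; exact hgk)
  have h3 : y.1 (eqf k (kpi J _ k)) = false := hyQ.2
  rw [h3] at h2
  exact absurd h2 (by simp)

/-- Every element of an `S1`-sort is the decided value of some constant. -/
theorem exists_dec {T : Set (MForm σ [])} {S1 : Set σ.Sorts} {h01 : S0 ⊆ S1}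
    (himp : ImplInterp T S0 S1 h01) (hM : M.Models T) (s : S1) (e : M.dom s.1) :
    ∃ (F : Finset (Phi M S0)) (x : Diag M S0) (k : (KS M S0).dom s.1) (u : Val M), Dec F x k ∧
      (∀ p ∈ F, Th S0 u p = x.1 p) ∧ ev S0 u s.1 k = e := by
  classical
  have hall : {x : Diag M S0 | ∀ q : (Σ s : S1, (KS M S0).dom s.1), ∃ F, Dec F x q.2} ∈
      residual (Diag M S0) :=
    eventually_countable_forall.2 fun q => dec_residual himp hM q.1 q.2
  have : Nonempty (Diag M S0) := ⟨thD S0 (fun _ p => p.1)⟩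
  obtain ⟨x, hxG, hx⟩ := (dense_of_mem_residual (Filter.inter_mem gen_residual hall)).nonempty
  choose F hF using hx
  have hu := fun q => agree x (F q)
  choose u hu using hu
  have hval : ∀ (s : S1) (k : (KS M S0).dom s.1) (v : Val M), (∀ p ∈ F ⟨s, k⟩, Th S0 v p = x.1 p) →
      ev S0 v s.1 k = ev S0 (u ⟨s, k⟩) s.1 k := fun s k v hv => hF ⟨s, k⟩ _ _ hv (hu _)
  have hk : KHom h01 x (fun s k => ev S0 (u ⟨s, k⟩) s.1 k) := by
    refine ⟨?_, ?_, ?_⟩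
    · intro s k k' h
      obtain ⟨v, hv⟩ := agree x (insert (eqf k k') (F ⟨s, k⟩ ∪ F ⟨s, k'⟩))
      rw [← hval s k v (fun p hp => hv p (by simp [hp])),
        ← hval s k' v (fun p hp => hv p (by simp [hp])), ← Th_eqf, hv _ (by simp), h]
    · intro s h m
      rfl
    · intro r hr k h
      obtain ⟨v, hv⟩ := agree x (insert (relf r k)
        (Finset.univ.biUnion fun i => F ⟨⟨_, hr i⟩, k i⟩))
      have : (fun i => ev S0 (u ⟨⟨_, hr i⟩, k i⟩) _ (k i)) = (fun i => ev S0 v _ (k i)) := by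
        funext i
        refine (hval ⟨_, hr i⟩ (k i) v (fun p hp => hv p ?_)).symm
        refine Finset.mem_insert_of_mem (Finset.mem_biUnion.2 ⟨i, Finset.mem_univ i, hp⟩)
      change M.rel r (fun i => ev S0 (u ⟨⟨_, hr i⟩, k i⟩) _ (k i))
      rw [this, ← Th_relf, hv _ (by simp), h]
  obtain ⟨k, hke⟩ := ((khom_of_implInterp himp hM hxG).2.2 _ hk s).1 e
  exact ⟨F ⟨s, k⟩, x, k, u ⟨s, k⟩, hF ⟨s, k⟩, hu _, hke⟩

end Decide

/-! ### From decided constants to formulas -/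

section Defin

variable {M : MStr σ} {S0 : Set σ.Sorts}

variable (M S0) in
abbrev Cst : Type := Σ s : σ.Sorts, (KS M S0).dom s

def kenv : ∀ C : List (Cst M S0), MEnv (KS M S0) (C.map Sigma.fst)
  | [] => MEnv.nil
  | c :: C => MEnv.cons c.2 (kenv C)

theorem kenv_mem : ∀ (C : List (Cst M S0)) (i : Fin (C.map Sigma.fst).length),
    (⟨(C.map Sigma.fst).get i, kenv C i⟩ : Cst M S0) ∈ C
  | [], i => i.elim0
  | c :: C, i => by
    refine Fin.cases (motive := fun i => (⟨((c :: C).map Sigma.fst).get i, kenv (c :: C) i⟩ :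
      Cst M S0) ∈ c :: C) ?_ (fun j => ?_) i
    · exact List.mem_cons_self
    · exact List.mem_cons_of_mem _ (kenv_mem C j)

theorem exists_var : ∀ (C : List (Cst M S0)) (c : Cst M S0), c ∈ C →
    ∃ v : MVar (C.map Sigma.fst) c.1, v.val (kenv C) = c.2
  | [], c, h => by simp at h
  | d :: C, c, h => by
    rcases List.mem_cons.1 h with rfl | h
    · exact ⟨vzero, rfl⟩
    · obtain ⟨v, hv⟩ := exists_var C c h
      exact ⟨vsucc v, hv⟩

theorem exists_ren (C : List (Cst M S0)) {Γ : List σ.Sorts} (κ : MEnv (KS M S0) Γ)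
    (h : ∀ i, (⟨Γ.get i, κ i⟩ : Cst M S0) ∈ C) :
    ∃ r : Ren Γ (C.map Sigma.fst), ∀ u : Val M,
      r.pull (emap (ev S0 u) (kenv C)) = emap (ev S0 u) κ := by
  have := fun i => exists_var C _ (h i)
  choose r hr using this
  refine ⟨r, fun u => funext fun i => ?_⟩
  change (r i).val _ = ev S0 u _ (κ i)
  rw [val_emap, hr]

def DefOn (C : List (Cst M S0)) (P : Val M → Prop) : Prop :=
  ∃ φ : MForm σ (C.map Sigma.fst), ∀ u, P u ↔ φ.Sat (emap (ev S0 u) (kenv C))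

theorem defOn_form (C : List (Cst M S0)) {Γ : List σ.Sorts} (φ : MForm σ Γ)
    (κ : MEnv (KS M S0) Γ) (h : ∀ i, (⟨Γ.get i, κ i⟩ : Cst M S0) ∈ C) :
    DefOn C (fun u => φ.Sat (emap (ev S0 u) κ)) := by
  obtain ⟨r, hr⟩ := exists_ren C κ h
  refine ⟨rename φ r, fun u => ?_⟩
  rw [sat_rename, hr]

theorem DefOn.mono {C C' : List (Cst M S0)} {P : Val M → Prop} (h : DefOn C P) (hC : C ⊆ C') :
    DefOn C' P := by
  obtain ⟨φ, hφ⟩ := h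
  obtain ⟨ψ, hψ⟩ := defOn_form C' φ (kenv C) (fun i => hC (kenv_mem C i))
  exact ⟨ψ, fun u => (hφ u).trans (hψ u)⟩

theorem DefOn.not {C : List (Cst M S0)} {P : Val M → Prop} (h : DefOn C P) :
    DefOn C (fun u => ¬ P u) := by
  obtain ⟨φ, hφ⟩ := h
  exact ⟨φ.not, fun u => not_congr (hφ u)⟩

theorem DefOn.and {C : List (Cst M S0)} {P Q : Val M → Prop} (h : DefOn C P) (h' : DefOn C Q) :
    DefOn C (fun u => P u ∧ Q u) := by
  obtain ⟨φ, hφ⟩ := h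
  obtain ⟨ψ, hψ⟩ := h'
  refine ⟨(φ.imp ψ.not).not, fun u => ?_⟩
  have h1 := hφ u
  have h2 := hψ u
  simp only [MForm.not, MForm.Sat]
  tauto

theorem defOn_Th (C : List (Cst M S0)) (p : Phi M S0) (b : Bool)
    (h : ∀ i, (⟨p.1.get i, p.2.2 i⟩ : Cst M S0) ∈ C) : DefOn C (fun u => Th S0 u p = b) := by
  have h1 : DefOn C (fun u => Th S0 u p = true) := by
    simp only [Th_eq_true]
    exact defOn_form C p.2.1 p.2.2 h
  cases b
  · simpa using h1.not
  · exact h1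

theorem defOn_list (C : List (Cst M S0)) (x : Phi M S0 → Bool) : ∀ (l : List (Phi M S0)),
    (∀ p ∈ l, ∀ i, (⟨p.1.get i, p.2.2 i⟩ : Cst M S0) ∈ C) →
    DefOn C (fun u => ∀ p ∈ l, Th S0 u p = x p)
  | [], _ => ⟨MForm.fal.not, fun u => by simp [MForm.not, MForm.Sat]⟩
  | p :: l, h => by
    have h1 := defOn_Th C p (x p) (h p (by simp))
    have h2 := defOn_list C x l (fun q hq => h q (by simp [hq]))
    simpa using h1.and h2

theorem defOn_eq (C : List (Cst M S0)) {s : σ.Sorts} (k k' : (KS M S0).dom s)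
    (h : (⟨s, k⟩ : Cst M S0) ∈ C) (h' : (⟨s, k'⟩ : Cst M S0) ∈ C) :
    DefOn C (fun u => ev S0 u s k = ev S0 u s k') := by
  obtain ⟨v, hv⟩ := exists_var C _ h
  obtain ⟨w, hw⟩ := exists_var C _ h'
  refine ⟨MForm.eq v w, fun u => ?_⟩
  simp only [MForm.Sat, val_emap, hv, hw]

/-- Is a constant a name of an element? -/
def isN (c : Cst M S0) : Bool := Sum.elim (fun _ => true) (fun _ => false) c.2

theorem isN_ev {c : Cst M S0} (h : isN c = true) (u u' : Val M) :
    ev S0 u c.1 c.2 = ev S0 u' c.1 c.2 := by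
  obtain ⟨s, k | k⟩ := c
  · rfl
  · exact absurd h (by simp [isN])

theorem isN_sort {c : Cst M S0} (h : isN c = true) : c.1 ∈ S0 := by
  obtain ⟨s, k | k⟩ := c
  · exact k.1.down
  · exact absurd h (by simp [isN])

theorem exists_upd (u : Val M) (c : Cst M S0) (hc : isN c = false) (x : M.dom c.1) :
    ∃ u' : Val M, ev S0 u' c.1 c.2 = x ∧ ∀ d : Cst M S0, d ≠ c →
      ev S0 u' d.1 d.2 = ev S0 u d.1 d.2 := by
  classical
  obtain ⟨s, k | q⟩ := c
  · exact absurd hc (by simp [isN])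
  · obtain ⟨w, hw⟩ : ∃ w : ∀ t, M.dom t × ℕ → M.dom t, w = u := ⟨u, rfl⟩
    subst hw
    refine ⟨(Function.update w s (Function.update (w s) q x) :
      ∀ t, M.dom t × ℕ → M.dom t), ?_, ?_⟩
    · change (Function.update w s (Function.update (w s) q x) :
        ∀ t, M.dom t × ℕ → M.dom t) s q = x
      rw [Function.update_self, Function.update_self]
    · rintro ⟨t, k | p⟩ hd
      · rfl
      · change (Function.update w s (Function.update (w s) q x) :
          ∀ t, M.dom t × ℕ → M.dom t) t p = w t p
        by_cases hts : t = s
        · subst hts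
          have : p ≠ q := by rintro rfl; exact hd rfl
          rw [Function.update_self, Function.update_of_ne this]
        · rw [Function.update_of_ne hts]

theorem emap_congr {C : List (Cst M S0)} {u u' : Val M}
    (h : ∀ d ∈ C, ev S0 u d.1 d.2 = ev S0 u' d.1 d.2) :
    emap (ev S0 u) (kenv C) = emap (ev S0 u') (kenv C) :=
  funext fun i => h _ (kenv_mem C i)

theorem defOn_ex {C : List (Cst M S0)} {c : Cst M S0} (hc : isN c = false) (hC : c ∉ C)
    {P : Val M → Prop} (h : DefOn (c :: C) P) :
    ∃ P', DefOn C P' ∧ (∀ u, P u → P' u) ∧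
      ∀ u, P' u → ∃ u', P u' ∧ ∀ d ∈ C, ev S0 u' d.1 d.2 = ev S0 u d.1 d.2 := by
  obtain ⟨φ, hφ⟩ := h
  have hex : ∀ u, (MForm.ex c.1 φ).Sat (emap (ev S0 u) (kenv C)) ↔
      ∃ x, φ.Sat (MEnv.cons x (emap (ev S0 u) (kenv C))) := by
    intro u
    simp [MForm.ex, MForm.not, MForm.Sat]
  have hcons : ∀ u, emap (ev S0 u) (kenv (c :: C)) =
      MEnv.cons (ev S0 u c.1 c.2) (emap (ev S0 u) (kenv C)) := fun u => emap_cons _ _ _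
  refine ⟨_, ⟨MForm.ex c.1 φ, fun u => Iff.rfl⟩, ?_, ?_⟩
  · intro u hu
    rw [hφ, hcons] at hu
    exact (hex u).2 ⟨_, hu⟩
  · intro u hu
    obtain ⟨x, hx⟩ := (hex u).1 hu
    obtain ⟨u', h1, h2⟩ := exists_upd u c hc x
    have h3 : ∀ d ∈ C, ev S0 u' d.1 d.2 = ev S0 u d.1 d.2 :=
      fun d hd => h2 d (fun h => hC (h ▸ hd))
    refine ⟨u', ?_, h3⟩
    rw [hφ, hcons, h1, emap_congr h3]
    exact hx

theorem defOn_exs (C : List (Cst M S0)) : ∀ (L : List (Cst M S0)) (_ : ∀ c ∈ L, isN c = false)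
    (P : Val M → Prop) (_ : DefOn (L ++ C) P), ∃ P', DefOn C P' ∧ (∀ u, P u → P' u) ∧
      ∀ u, P' u → ∃ u', P u' ∧ ∀ d ∈ C, ev S0 u' d.1 d.2 = ev S0 u d.1 d.2
  | [], _, P, h => ⟨P, h, fun _ hu => hu, fun u hu => ⟨u, hu, fun _ _ => rfl⟩⟩
  | c :: L, hL, P, h => by
    have hL' : ∀ d ∈ L, isN d = false := fun d hd => hL d (by simp [hd])
    by_cases hc : c ∈ L ++ C
    · refine defOn_exs C L hL' P (h.mono ?_)
      intro d hd
      rcases List.mem_cons.1 hd with rfl | hd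
      · exact hc
      · exact hd
    · obtain ⟨P1, h1, h2, h3⟩ := defOn_ex (C := L ++ C) (hL c (by simp)) hc h
      obtain ⟨P2, k1, k2, k3⟩ := defOn_exs C L hL' P1 h1
      refine ⟨P2, k1, fun u hu => k2 u (h2 u hu), fun u hu => ?_⟩
      obtain ⟨v, hv, hv'⟩ := k3 u hu
      obtain ⟨w, hw, hw'⟩ := h3 v hv
      exact ⟨w, hw, fun d hd => (hw' d (by simp [hd])).trans (hv' d hd)⟩

theorem definable_of_dec {F : Finset (Phi M S0)} {x : Diag M S0} {s : σ.Sorts}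
    {k : (KS M S0).dom s} (hD : Dec F x k) (u : Val M) (hu : ∀ p ∈ F, Th S0 u p = x.1 p) :
    ∃ Δ : List σ.Sorts, (∀ t ∈ Δ, t ∈ S0) ∧ ∃ (ψ : MForm σ (s :: Δ)) (a : MEnv M Δ),
      ∀ y : M.dom s, ψ.Sat (MEnv.cons y a) ↔ y = ev S0 u s k := by
  obtain ⟨J, hkJ, hJ⟩ := exists_bd F (kbd k)
  let z : Cst M S0 := ⟨s, cgen S0 (ev S0 u s k, J)⟩
  let A : List (Cst M S0) := ⟨s, k⟩ :: F.toList.flatMap (fun p =>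
    List.ofFn fun i => (⟨p.1.get i, p.2.2 i⟩ : Cst M S0))
  let L := A.filter (fun c => !isN c)
  let B := A.filter isN
  have hA : A ⊆ L ++ z :: B := by
    intro c hc
    cases h : isN c
    · exact List.mem_append_left _ (List.mem_filter.2 ⟨hc, by simp [h]⟩)
    · exact List.mem_append_right _ (List.mem_cons_of_mem _ (List.mem_filter.2 ⟨hc, h⟩))
  have hF : ∀ p ∈ F.toList, ∀ i, (⟨p.1.get i, p.2.2 i⟩ : Cst M S0) ∈ L ++ z :: B := by
    intro p hp i
    refine hA (List.mem_cons_of_mem _ (List.mem_flatMap.2 ⟨p, hp, ?_⟩))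
    exact (List.mem_ofFn' _ _).2 ⟨i, rfl⟩
  have hP := (defOn_list (L ++ z :: B) x.1 F.toList hF).and
    (defOn_eq (L ++ z :: B) k z.2 (hA List.mem_cons_self) (by simp [z]))
  obtain ⟨P', ⟨ψ, hψ⟩, h2, h3⟩ := defOn_exs (z :: B) L
    (fun c hc => by simpa using (List.mem_filter.1 hc).2) _ hP
  have hcons : ∀ v, emap (ev S0 v) (kenv (z :: B)) =
      MEnv.cons (ev S0 v s z.2) (emap (ev S0 v) (kenv B)) := fun v => emap_cons _ _ _
  have hB : ∀ v, emap (ev S0 v) (kenv B) = emap (ev S0 u) (kenv B) := fun v =>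
    emap_congr fun d hd => isN_ev (List.mem_filter.1 hd).2 _ _
  refine ⟨B.map Sigma.fst, ?_, ψ, emap (ev S0 u) (kenv B), ?_⟩
  · intro t ht
    obtain ⟨c, hc, rfl⟩ := List.mem_map.1 ht
    exact isN_sort (List.mem_filter.1 hc).2
  intro y
  have hy : ev S0 (upd u s J y) s z.2 = y := upd_same _ _ _ _ _
  have key : ψ.Sat (MEnv.cons y (emap (ev S0 u) (kenv B))) ↔ P' (upd u s J y) := by
    rw [hψ, hcons, hB (upd u s J y), hy]
  rw [key]
  constructor
  · intro h
    obtain ⟨v, ⟨hv1, hv2⟩, hv3⟩ := h3 _ h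
    have h4 := hv3 z List.mem_cons_self
    have h5 := hD v u (fun p hp => hv1 p (by simpa using hp)) hu
    rw [← h5, hv2]
    exact (hy.symm.trans h4.symm)
  · intro h
    refine h2 _ ⟨?_, ?_⟩
    · intro p hp
      rw [Finset.mem_toList] at hp
      rw [← hu p hp]
      exact Th_congr fun i => ev_upd _ _ _ _ _ (hJ p hp i)
    · rw [ev_upd _ _ _ _ _ hkJ, hy, h]

end Defin

/-- The renaming leaving room for one extra variable in second position. -/
def skipRen (s : σ.Sorts) (Δ : List σ.Sorts) : Ren (s :: Δ) (s :: s :: Δ) :=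
  fun i => Fin.cases (motive := fun i => MVar (s :: s :: Δ) ((s :: Δ).get i))
    vzero (fun j => vsucc (vsucc ⟨j, rfl⟩)) i

theorem pull_skipRen {A : MStr σ} {s : σ.Sorts} {Δ : List σ.Sorts} (x y : A.dom s)
    (a : MEnv A Δ) : (skipRen s Δ).pull (MEnv.cons x (MEnv.cons y a)) = MEnv.cons x a := by
  funext i
  refine Fin.cases ?_ (fun j => ?_) i <;> rfl

def uniq {s : σ.Sorts} {Δ : List σ.Sorts} (ψ : MForm σ (s :: Δ)) : MForm σ (s :: Δ) :=
  .all s ((rename ψ (skipRen s Δ)).imp (.eq vzero (vsucc vzero)))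

theorem sat_uniq {A : MStr σ} {s : σ.Sorts} {Δ : List σ.Sorts} (ψ : MForm σ (s :: Δ))
    (y : A.dom s) (a : MEnv A Δ) : (uniq ψ).Sat (MEnv.cons y a) ↔
      ∀ x, ψ.Sat (MEnv.cons x a) → x = y := by
  simp only [uniq, MForm.Sat, sat_rename, pull_skipRen]
  rfl

end Coord

/-- **Element-wise definability from the input sorts** (Lemma 3.17, the multi-sorted
Gaifman coordinatisation): if `S₁` is implicitly interpretable over `S₀ ⊆ S₁` relative to
a theory `T` in a countable language, then in any model `M` of `T`, every element `e` of
a sort `s ∈ S₁` is definable with parameters from `S₀`: there are a context `Δ` of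
`S₀`-sorts, a formula `ψ(ȳ, x)` and a parameter tuple `ā` over `Δ` such that `e` is the
unique element of `M.dom s` satisfying `ψ(ā, x)`. -/
theorem implicit_interp_elementwise_definable (σ : MSig)
    [Countable σ.Sorts] [Countable σ.Rels]
    (T : Set (MForm σ [])) (S0 S1 : Set σ.Sorts) (h01 : S0 ⊆ S1)
    (himp : ImplInterp T S0 S1 h01)
    (M : MStr σ) (hM : M.Models T)
    (s : σ.Sorts) (hs : s ∈ S1) (e : M.dom s) :
    ∃ (Δ : List σ.Sorts), (∀ t ∈ Δ, t ∈ S0) ∧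
      ∃ (ψ : MForm σ (s :: Δ)) (a : MEnv M Δ),
        ∀ x : M.dom s, ψ.Sat (MEnv.cons x a) ↔ x = e :=  by
  obtain ⟨M₀, ι, hc, hel, e₀, rfl⟩ := Coord.exists_countable_elem M s e
  have hM₀ : M₀.Models T := by
    intro φ hφ
    rw [hel, Coord.env_nil (Coord.emap ι _)]
    exact hM φ hφ
  obtain ⟨F, x, k, u, hD, hu, rfl⟩ := Coord.exists_dec himp hM₀ ⟨s, hs⟩ e₀
  obtain ⟨Δ, hΔ, ψ, a, h⟩ := Coord.definable_of_dec hD u hu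
  refine ⟨Δ, hΔ, ψ, Coord.emap ι a, fun y => ⟨fun hy => ?_, ?_⟩⟩
  · have h1 := (Coord.sat_uniq ψ _ a).2 fun x hx => (h x).1 hx
    rw [hel, Coord.emap_cons, Coord.sat_uniq] at h1
    exact h1 y hy
  · rintro rfl
    rw [← Coord.emap_cons, ← hel]
    exact (h _).2 rfl
end
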